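/- Let d be a positive integer. There exist constants 0 < c ≤ C such that for every positive integer n and every point set P = {x_1, …, x_n} ⊂ S^d, the minimal weighted spherical L_2-discrepancy satisfies c·‖dist_{S^d}(·, P)‖_{L_{d+1}(σ_d)}^{(d+1)/2} ≤ inf_{w ∈ ℝ^n} D_2({(x_j, w_j)}_{j=1}^n) ≤ C·‖dist_{S^d}(·, P)‖_{L_{d+1}(σ_d)}^{(d+1)/2}, where the infimum is over all weight vectors w = (w_1, …, w_n) ∈ ℝ^n. -/

import Mathlib

open MeasureTheory Metric
open scoped RealInnerProductSpace

noncomputable section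

/-- The unit sphere `S^d ⊂ ℝ^{d+1}`. -/
abbrev Sph (d : ℕ) : Type := sphere (0 : EuclideanSpace ℝ (Fin (d + 1))) 1

/-- The normalized rotation-invariant (uniform) probability measure `σ_d` on `S^d`. -/
def sigmaSph (d : ℕ) : Measure (Sph d) :=
  ((volume : Measure (EuclideanSpace ℝ (Fin (d + 1)))).toSphere Set.univ)⁻¹ •
    (volume : Measure (EuclideanSpace ℝ (Fin (d + 1)))).toSphere

/-- The geodesic distance `arccos(x·y)` on `S^d`. -/
def geoDist {d : ℕ} (x y : Sph d) : ℝ :=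
  Real.arccos ⟪(x : EuclideanSpace ℝ (Fin (d + 1))), (y : EuclideanSpace ℝ (Fin (d + 1)))⟫

/-- The spherical cap `C(z,t) = {y ∈ S^d : z·y ≥ t}`. -/
def sphCap {d : ℕ} (z : Sph d) (t : ℝ) : Set (Sph d) :=
  {y : Sph d | t ≤ ⟪(z : EuclideanSpace ℝ (Fin (d + 1))), (y : EuclideanSpace ℝ (Fin (d + 1)))⟫}

/-- The weighted spherical `L_2`-discrepancy of points `x` with weights `w`. -/
def sphDisc {d n : ℕ} (x : Fin n → Sph d) (w : Fin n → ℝ) : ℝ :=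
  Real.sqrt (∫ t in Set.Icc (-1 : ℝ) 1, ∫ z, (∑ j, w j *
      (sphCap z t).indicator (fun _ => (1 : ℝ)) (x j) -
      ((sigmaSph d) (sphCap z t)).toReal) ^ 2 ∂(sigmaSph d))

/-- The ambient Euclidean space `ℝ^{d+1}` of the sphere `S^d`. -/
abbrev Amb (d : ℕ) : Type := EuclideanSpace ℝ (Fin (d + 1))

section Sphere

variable {d : ℕ}

open scoped Pointwise ENNReal

instance sigmaSph_isProbabilityMeasure : IsProbabilityMeasure (sigmaSph d) := by
  refine ⟨?_⟩
  have h0 : (volume : Measure (Amb d)).toSphere Set.univ ≠ 0 := by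
    rw [Ne, Measure.measure_univ_eq_zero]
    exact Measure.toSphere_ne_zero _
  rw [sigmaSph, Measure.smul_apply, smul_eq_mul,
    ENNReal.inv_mul_cancel h0 (measure_ne_top _ _)]

/-- The action of a linear isometry on the sphere. -/
def sphMap (L : Amb d ≃ₗᵢ[ℝ] Amb d) (x : Sph d) : Sph d :=
  ⟨L x, by simp⟩

lemma coe_sphMap (L : Amb d ≃ₗᵢ[ℝ] Amb d) (x : Sph d) : (sphMap L x : Amb d) = L x := rfl

lemma continuous_sphMap (L : Amb d ≃ₗᵢ[ℝ] Amb d) : Continuous (sphMap L) := by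
  unfold sphMap
  fun_prop

lemma measurePreserving_sphMap (L : Amb d ≃ₗᵢ[ℝ] Amb d) :
    MeasurePreserving (sphMap L) (sigmaSph d) (sigmaSph d) := by
  have hm := (continuous_sphMap L).measurable
  refine ⟨hm, ?_⟩
  ext s hs
  rw [Measure.map_apply hm hs, sigmaSph, Measure.smul_apply, Measure.smul_apply,
    Measure.toSphere_apply' _ hs, Measure.toSphere_apply' _ (hm hs)]
  congr 2
  rw [← L.measurePreserving.measure_preimage_equiv (f := L.toMeasurableEquiv)
    (Set.Ioo (0 : ℝ) 1 • (Subtype.val '' s))]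
  congr 1
  ext v
  simp only [Set.mem_smul, Set.mem_image, Set.mem_preimage,
    LinearIsometryEquiv.coe_toMeasurableEquiv]
  constructor
  · rintro ⟨r, hr, _, ⟨x, hx, rfl⟩, rfl⟩
    exact ⟨r, hr, _, ⟨sphMap L x, hx, rfl⟩, by simp [coe_sphMap]⟩
  · rintro ⟨r, hr, _, ⟨x, hx, rfl⟩, hv⟩
    refine ⟨r, hr, _, ⟨sphMap L.symm x, ?_, rfl⟩, ?_⟩
    · convert hx
      ext1
      simp [coe_sphMap]
    · apply L.injective
      simpa [coe_sphMap] using hv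

lemma exists_isometry_map_eq {u v : Amb d} (h : ‖u‖ = ‖v‖) :
    ∃ L : Amb d ≃ₗᵢ[ℝ] Amb d, L u = v :=
  ⟨_, Submodule.reflection_sub h⟩

lemma sigmaSph_ball_eq (x y : Sph d) (r : ℝ) :
    sigmaSph d (ball x r) = sigmaSph d (ball y r) := by
  obtain ⟨L, hL⟩ := exists_isometry_map_eq (u := (x : Amb d)) (v := y) (by simp)
  rw [← (measurePreserving_sphMap L).measure_preimage
    (measurableSet_ball (x := y)).nullMeasurableSet]
  congr 1
  ext z
  simp [Subtype.dist_eq, coe_sphMap, ← hL]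

/-- Double counting of the pairs of a point of the space and a point of the sphere at distance
less than `r`. -/
lemma lintegral_sigmaSph_near (r : ℝ) (hr : 0 ≤ r) :
    ∫⁻ u : Amb d, sigmaSph d {y | dist u y < r} =
      ENNReal.ofReal (r ^ (d + 1)) * volume (ball (0 : Amb d) 1) := by
  have hA : MeasurableSet {p : Amb d × Sph d | dist p.1 p.2 < r} :=
    (isOpen_lt (by fun_prop) (by fun_prop)).measurableSet
  have h1 := Measure.prod_apply (μ := (volume : Measure (Amb d))) (ν := sigmaSph d) hA
  rw [Measure.prod_apply_symm hA] at h1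
  have h2 : ∀ y : Sph d, volume ((fun u : Amb d => (u, y)) ⁻¹' {p | dist p.1 p.2 < r}) =
      ENNReal.ofReal (r ^ (d + 1)) * volume (ball (0 : Amb d) 1) := fun y => by
    have := Measure.addHaar_ball (volume : Measure (Amb d)) (y : Amb d) hr
    rw [finrank_euclideanSpace_fin] at this
    rw [← this]
    rfl
  simp only [h2, lintegral_const, measure_univ, mul_one] at h1
  exact h1.symm

/-- The radial projection of a nonzero vector to the sphere. -/
def radial (u : Amb d) (hu : u ≠ 0) : Sph d :=
  ⟨‖u‖⁻¹ • u, by simp [norm_smul, hu]⟩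

lemma dist_radial (u : Amb d) (hu : u ≠ 0) : dist u (radial u hu) = |‖u‖ - 1| := by
  have h : u - (radial u hu : Amb d) = (‖u‖ - 1) • (‖u‖⁻¹ • u) := by
    have : ‖u‖ ≠ 0 := by simpa
    rw [sub_smul, smul_smul, mul_inv_cancel₀ this, one_smul, one_smul]
    rfl
  rw [dist_eq_norm, h, norm_smul, norm_smul, norm_inv, norm_norm,
    inv_mul_cancel₀ (by simpa), mul_one, Real.norm_eq_abs]

lemma volume_ball_zero (r : ℝ) (hr : 0 ≤ r) : volume (ball (0 : Amb d) r) =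
    ENNReal.ofReal (r ^ (d + 1)) * volume (ball (0 : Amb d) 1) := by
  have := Measure.addHaar_ball (volume : Measure (Amb d)) (0 : Amb d) hr
  rwa [finrank_euclideanSpace_fin] at this

lemma volume_shell (a b : ℝ) (ha : 0 ≤ a) (hab : a ≤ b) :
    volume (ball (0 : Amb d) b \ ball 0 a) =
      ENNReal.ofReal (b ^ (d + 1) - a ^ (d + 1)) * volume (ball (0 : Amb d) 1) := by
  rw [measure_sdiff (ball_subset_ball hab) measurableSet_ball.nullMeasurableSet
    measure_ball_lt_top.ne, volume_ball_zero _ ha, volume_ball_zero _ (ha.trans hab),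
    ENNReal.ofReal_sub _ (by positivity), ENNReal.sub_mul]
  intros
  exact measure_ball_lt_top.ne

lemma sigmaSph_ball_le (x : Sph d) {r : ℝ} (hr : 0 < r) :
    sigmaSph d (ball x r) ≤ ENNReal.ofReal (2 ^ (d + 1) * r ^ d) := by
  rcases le_or_gt 1 r with h1 | h1
  · refine prob_le_one.trans ?_
    rw [← ENNReal.ofReal_one]
    apply ENNReal.ofReal_le_ofReal
    exact one_le_mul_of_one_le_of_one_le (one_le_pow₀ one_le_two) (one_le_pow₀ h1)
  have key := lintegral_sigmaSph_near (d := d) (2 * r) (by positivity)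
  have hle : ∫⁻ u : Amb d in ball 0 1 \ ball 0 (1 - r), sigmaSph d (ball x r) ≤
      ∫⁻ u : Amb d, sigmaSph d {y | dist u y < 2 * r} := by
    refine (setLIntegral_mono' (measurableSet_ball.diff measurableSet_ball) ?_).trans
      (setLIntegral_le_lintegral _ _)
    intro u hu
    simp only [Set.mem_sdiff, mem_ball, dist_zero_right, not_lt] at hu
    have hu0 : u ≠ 0 := by
      rintro rfl
      simp at hu
      linarith
    rw [sigmaSph_ball_eq x (radial u hu0)]
    apply measure_mono
    intro y hy
    have h2 := dist_radial u hu0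
    rw [abs_of_nonpos (by linarith)] at h2
    have := dist_triangle u (radial u hu0 : Amb d) y
    rw [mem_ball, dist_comm, Subtype.dist_eq] at hy
    show dist u y < 2 * r
    linarith
  rw [setLIntegral_const, volume_shell _ _ (by linarith) (by linarith), key, ← mul_assoc] at hle
  have hV0 : volume (ball (0 : Amb d) 1) ≠ 0 := (measure_ball_pos _ _ one_pos).ne'
  rw [ENNReal.mul_le_mul_iff_left hV0 measure_ball_lt_top.ne] at hle
  have hsh : r ≤ 1 ^ (d + 1) - (1 - r) ^ (d + 1) := by
    have : (1 - r) ^ (d + 1) ≤ 1 - r := by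
      rw [pow_succ]
      exact mul_le_of_le_one_left (by linarith) (pow_le_one₀ (by linarith) (by linarith))
    simp only [one_pow]
    linarith
  have h3 : sigmaSph d (ball x r) * ENNReal.ofReal r ≤
      ENNReal.ofReal (2 ^ (d + 1) * r ^ d) * ENNReal.ofReal r := by
    rw [← ENNReal.ofReal_mul (by positivity)]
    refine le_trans ?_ (hle.trans (le_of_eq ?_))
    · gcongr
    · congr 1
      ring
  rwa [ENNReal.mul_le_mul_iff_left (by simpa) ENNReal.ofReal_ne_top] at h3

lemma sigmaSph_ball_ge (x : Sph d) {r : ℝ} (hr : 0 < r) (hr2 : r ≤ 2) :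
    ENNReal.ofReal (((2 : ℝ) ^ d * (2 ^ (d + 1) + (d + 1)))⁻¹ * r ^ d) ≤ sigmaSph d (ball x r) := by
  obtain ⟨s, rfl⟩ : ∃ s, r = 2 * s := ⟨r / 2, by ring⟩
  have hs : 0 < s := by linarith
  have hs1 : s ≤ 1 := by linarith
  have key := lintegral_sigmaSph_near (d := d) s hs.le
  have hle : ∫⁻ u : Amb d, sigmaSph d {y | dist u y < s} ≤
      ∫⁻ u : Amb d in ball 0 (1 + s) \ ball 0 (1 - s), sigmaSph d (ball x (2 * s)) := by
    rw [← lintegral_indicator (measurableSet_ball.diff measurableSet_ball)]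
    apply lintegral_mono
    intro u
    by_cases hne : ∃ y : Sph d, dist u y < s
    · obtain ⟨y₀, hy₀⟩ := hne
      have hn : ‖(y₀ : Amb d)‖ = 1 := by simp
      have hab : |‖u‖ - 1| < s := by
        rw [← hn]
        exact (abs_norm_sub_norm_le _ _).trans_lt (by rwa [← dist_eq_norm])
      rw [abs_lt] at hab
      have hu0 : u ≠ 0 := by
        rintro rfl
        simp at hab
        linarith
      rw [Set.indicator_of_mem (by simp; constructor <;> linarith),
        sigmaSph_ball_eq x (radial u hu0)]
      apply measure_mono
      intro y hy
      have h2 := dist_radial u hu0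
      have h3 : |‖u‖ - 1| < s := abs_lt.2 hab
      have := dist_triangle (y : Amb d) u (radial u hu0 : Amb d)
      rw [mem_ball, Subtype.dist_eq]
      have h4 : dist u y < s := hy
      rw [dist_comm] at h4
      linarith
    · push Not at hne
      have : {y : Sph d | dist u y < s} = ∅ := by
        ext y
        simpa using hne y
      simp [this]
  rw [setLIntegral_const, volume_shell _ _ (by linarith) (by linarith), key, ← mul_assoc] at hle
  have hV0 : volume (ball (0 : Amb d) 1) ≠ 0 := (measure_ball_pos _ _ one_pos).ne'
  rw [ENNReal.mul_le_mul_iff_left hV0 measure_ball_lt_top.ne] at hle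
  have hup : ∀ k : ℕ, (1 + s) ^ k ≤ 1 + 2 ^ k * s := by
    intro k
    induction k with
    | zero => simp [hs.le]
    | succ k ih =>
      have h2k : (1 : ℝ) ≤ 2 ^ k := one_le_pow₀ one_le_two
      have : (1 + s) ^ (k + 1) = (1 + s) ^ k + s * (1 + s) ^ k := by ring
      have h5 : (1 + s) ^ k ≤ 2 ^ k := by gcongr; linarith
      have := mul_le_mul_of_nonneg_left h5 hs.le
      rw [pow_succ 2 k]
      nlinarith
  have hlo := one_add_mul_le_pow (a := -s) (by linarith) (d + 1)
  have hsh : (1 + s) ^ (d + 1) - (1 - s) ^ (d + 1) ≤ (2 ^ (d + 1) + (d + 1)) * s := by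
    have := hup (d + 1)
    rw [← sub_eq_add_neg] at hlo
    push_cast at hlo
    nlinarith
  have hpos : (0 : ℝ) < (2 ^ (d + 1) + (d + 1)) * s := by positivity
  have h3 : ENNReal.ofReal (((2 : ℝ) ^ d * (2 ^ (d + 1) + (d + 1)))⁻¹ * (2 * s) ^ d) *
      ENNReal.ofReal ((2 ^ (d + 1) + (d + 1)) * s) ≤
      sigmaSph d (ball x (2 * s)) * ENNReal.ofReal ((2 ^ (d + 1) + (d + 1)) * s) := by
    rw [← ENNReal.ofReal_mul (by positivity)]
    refine le_trans (le_of_eq ?_) (hle.trans ?_)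
    · congr 1
      field_simp
      ring
    · gcongr
  rwa [ENNReal.mul_le_mul_iff_left (by simpa using hpos) ENNReal.ofReal_ne_top] at h3

end Sphere

section Energy

open scoped ENNReal

variable {Ω S : Type*} [MeasurableSpace Ω] [MeasurableSpace S]

lemma integrable_of_forall_abs_le_one {m : Measure S} [IsFiniteMeasure m] {f : S → ℝ}
    (hf : Measurable f) (hb : ∀ x, |f x| ≤ 1) : Integrable f m :=
  Integrable.of_bound hf.aestronglyMeasurable 1 (.of_forall hb)

lemma integrable_sq_of_forall_abs_le_one {m : Measure S} [IsFiniteMeasure m] {f : S → ℝ}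
    (hf : Measurable f) (hb : ∀ x, |f x| ≤ 1) : Integrable (fun x => f x ^ 2) m :=
  integrable_of_forall_abs_le_one (hf.pow_const 2) fun x => by
    rw [abs_pow]
    exact pow_le_one₀ (abs_nonneg _) (hb x)

lemma integral_sub_sq {m : Measure S} [IsFiniteMeasure m]
    {f : S → ℝ} (hf : Measurable f) (hb : ∀ x, |f x| ≤ 1) (a : ℝ) :
    Integrable (fun y => (a - f y) ^ 2) m ∧ ∫ y, (a - f y) ^ 2 ∂m =
      m.real Set.univ * a ^ 2 - (2 * ∫ y, f y ∂m) * a + ∫ y, f y ^ 2 ∂m := by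
  have hi : Integrable f m := integrable_of_forall_abs_le_one hf hb
  have hi2 : Integrable (fun x => f x ^ 2) m := integrable_sq_of_forall_abs_le_one hf hb
  have h1 : ∀ y, (a - f y) ^ 2 = a ^ 2 - 2 * a * f y + f y ^ 2 := fun y => by ring
  have hi3 : Integrable (fun y => a ^ 2 - 2 * a * f y) m :=
    (integrable_const _).sub (hi.const_mul _)
  simp only [h1]
  refine ⟨hi3.add hi2, ?_⟩
  rw [integral_add hi3 hi2, integral_sub (integrable_const _) (hi.const_mul _), integral_const,
    integral_const_mul, smul_eq_mul]
  ring

/-- The mutual energy of two measures with respect to the squared difference of `f`. -/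
lemma integral_integral_sub_sq {m₁ m₂ : Measure S} [IsFiniteMeasure m₁] [IsFiniteMeasure m₂]
    {f : S → ℝ} (hf : Measurable f) (hb : ∀ x, |f x| ≤ 1) :
    Integrable (fun x => ∫ y, (f x - f y) ^ 2 ∂m₂) m₁ ∧
    ∫ x, ∫ y, (f x - f y) ^ 2 ∂m₂ ∂m₁ =
      m₂.real Set.univ * (∫ x, f x ^ 2 ∂m₁) + m₁.real Set.univ * (∫ x, f x ^ 2 ∂m₂)
        - 2 * (∫ x, f x ∂m₁) * (∫ x, f x ∂m₂) := by
  have hi : Integrable f m₁ := integrable_of_forall_abs_le_one hf hb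
  have hi2 : Integrable (fun x => f x ^ 2) m₁ := integrable_sq_of_forall_abs_le_one hf hb
  simp only [(integral_sub_sq hf hb _).2]
  have hi3 : Integrable (fun x => m₂.real Set.univ * f x ^ 2 - (2 * ∫ y, f y ∂m₂) * f x) m₁ :=
    (hi2.const_mul _).sub (hi.const_mul _)
  refine ⟨hi3.add (integrable_const _), ?_⟩
  rw [integral_add hi3 (integrable_const _), integral_sub (hi2.const_mul _) (hi.const_mul _),
    integral_const, integral_const_mul, integral_const_mul, smul_eq_mul]
  ring

lemma lintegral_lintegral_sub_sq {m₁ m₂ : Measure S} [IsFiniteMeasure m₁] [IsFiniteMeasure m₂]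
    {f : S → ℝ} (hf : Measurable f) (hb : ∀ x, |f x| ≤ 1) :
    ∫⁻ x, ∫⁻ y, ENNReal.ofReal ((f x - f y) ^ 2) ∂m₂ ∂m₁ =
      ENNReal.ofReal (∫ x, ∫ y, (f x - f y) ^ 2 ∂m₂ ∂m₁) := by
  rw [ofReal_integral_eq_lintegral_ofReal (integral_integral_sub_sq hf hb).1
    (.of_forall fun y => integral_nonneg fun _ => sq_nonneg _)]
  refine lintegral_congr fun x => ?_
  rw [ofReal_integral_eq_lintegral_ofReal (integral_sub_sq hf hb _).1
    (.of_forall fun y => sq_nonneg _)]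

lemma two_mul_sq_integral_sub_add {m₁ m₂ : Measure S} [IsFiniteMeasure m₁] [IsFiniteMeasure m₂]
    (hm : m₁ Set.univ = m₂ Set.univ) {f : S → ℝ} (hf : Measurable f) (hb : ∀ x, |f x| ≤ 1) :
    2 * ENNReal.ofReal ((∫ x, f x ∂m₁ - ∫ x, f x ∂m₂) ^ 2) +
      (∫⁻ x, ∫⁻ y, ENNReal.ofReal ((f x - f y) ^ 2) ∂m₁ ∂m₁ +
        ∫⁻ x, ∫⁻ y, ENNReal.ofReal ((f x - f y) ^ 2) ∂m₂ ∂m₂) =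
      2 * ∫⁻ x, ∫⁻ y, ENNReal.ofReal ((f x - f y) ^ 2) ∂m₂ ∂m₁ := by
  have hm' : m₁.real Set.univ = m₂.real Set.univ := by simp [measureReal_def, hm]
  have key : ∀ m : Measure S, 0 ≤ ∫ x, ∫ y, (f x - f y) ^ 2 ∂m ∂m := fun m =>
    integral_nonneg fun _ => integral_nonneg fun _ => sq_nonneg _
  rw [lintegral_lintegral_sub_sq hf hb, lintegral_lintegral_sub_sq hf hb,
    lintegral_lintegral_sub_sq hf hb, ← ENNReal.ofReal_add (key m₁) (key m₂),
    ← ENNReal.ofReal_ofNat 2, ← ENNReal.ofReal_mul zero_le_two,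
    ← ENNReal.ofReal_mul zero_le_two,
    ← ENNReal.ofReal_add (by positivity) (add_nonneg (key m₁) (key m₂))]
  congr 1
  rw [(integral_integral_sub_sq hf hb).2, (integral_integral_sub_sq hf hb).2,
    (integral_integral_sub_sq hf hb).2, hm']
  ring

variable [PseudoMetricSpace S]

lemma lintegral_sq_integral_sub_add {τ : Measure Ω} [SFinite τ] {F : Ω → S → ℝ}
    (hF : Measurable (Function.uncurry F)) (hb : ∀ ω x, |F ω x| ≤ 1) {κ : ℝ≥0∞}
    (hκ : ∀ x y, ∫⁻ ω, ENNReal.ofReal ((F ω x - F ω y) ^ 2) ∂τ = κ * edist x y)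
    {m₁ m₂ : Measure S} [IsFiniteMeasure m₁] [IsFiniteMeasure m₂]
    (hm : m₁ Set.univ = m₂ Set.univ) :
    2 * ∫⁻ ω, ENNReal.ofReal ((∫ x, F ω x ∂m₁ - ∫ x, F ω x ∂m₂) ^ 2) ∂τ +
      (∫⁻ x, ∫⁻ y, κ * edist x y ∂m₁ ∂m₁ + ∫⁻ x, ∫⁻ y, κ * edist x y ∂m₂ ∂m₂) =
      2 * ∫⁻ x, ∫⁻ y, κ * edist x y ∂m₂ ∂m₁ := by
  have hmeas3 : Measurable fun p : Ω × S × S =>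
      ENNReal.ofReal ((F p.1 p.2.1 - F p.1 p.2.2) ^ 2) := by
    have h1 : Measurable fun p : Ω × S × S => F p.1 p.2.1 :=
      hF.comp (measurable_fst.prodMk (measurable_fst.comp measurable_snd))
    have h2 : Measurable fun p : Ω × S × S => F p.1 p.2.2 :=
      hF.comp (measurable_fst.prodMk (measurable_snd.comp measurable_snd))
    exact ((h1.sub h2).pow_const 2).ennreal_ofReal
  have hswap : ∀ (m m' : Measure S) [IsFiniteMeasure m] [IsFiniteMeasure m'],
      ∫⁻ x, ∫⁻ y, κ * edist x y ∂m' ∂m =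
        ∫⁻ ω, ∫⁻ x, ∫⁻ y, ENNReal.ofReal ((F ω x - F ω y) ^ 2) ∂m' ∂m ∂τ := by
    intro m m' _ _
    have h1 : ∀ x, ∫⁻ ω, ∫⁻ y, ENNReal.ofReal ((F ω x - F ω y) ^ 2) ∂m' ∂τ =
        ∫⁻ y, κ * edist x y ∂m' := fun x => by
      rw [lintegral_lintegral_swap]
      · simp only [hκ]
      · exact (hmeas3.comp (measurable_fst.prodMk
          (measurable_const.prodMk measurable_snd))).aemeasurable
    simp only [← h1]
    rw [lintegral_lintegral_swap]
    apply Measurable.aemeasurable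
    exact Measurable.lintegral_prod_right' (f := fun q : (S × Ω) × S =>
      ENNReal.ofReal ((F q.1.2 q.1.1 - F q.1.2 q.2) ^ 2))
      (hmeas3.comp ((measurable_snd.comp measurable_fst).prodMk
        ((measurable_fst.comp measurable_fst).prodMk measurable_snd)))
  have hmeasI : ∀ (m m' : Measure S) [IsFiniteMeasure m] [IsFiniteMeasure m'],
      Measurable fun ω => ∫⁻ x, ∫⁻ y, ENNReal.ofReal ((F ω x - F ω y) ^ 2) ∂m' ∂m := by
    intro m m' _ _
    refine Measurable.lintegral_prod_right' (f := fun q : Ω × S =>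
      ∫⁻ y, ENNReal.ofReal ((F q.1 q.2 - F q.1 y) ^ 2) ∂m') ?_
    exact Measurable.lintegral_prod_right' (f := fun q : (Ω × S) × S =>
        ENNReal.ofReal ((F q.1.1 q.1.2 - F q.1.1 q.2) ^ 2))
        (hmeas3.comp ((measurable_fst.comp measurable_fst).prodMk
          ((measurable_snd.comp measurable_fst).prodMk measurable_snd)))
  rw [hswap m₁ m₁, hswap m₂ m₂, hswap m₁ m₂, ← lintegral_add_left (hmeasI m₁ m₁),
    ← lintegral_const_mul _ (hmeasI m₁ m₂), ← lintegral_const_mul' _ _ (by simp),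
    ← lintegral_add_right _ ((hmeasI m₁ m₁).fun_add (hmeasI m₂ m₂))]
  refine lintegral_congr fun ω => ?_
  exact two_mul_sq_integral_sub_add hm (hF.comp measurable_prodMk_left) (hb ω)

/-- Two kernels whose squared differences integrate to multiples of the distance
give proportional energies to neutral charges. -/
lemma mul_lintegral_sq_integral_sub_eq [BoundedSpace S]
    {Ω' : Type*} [MeasurableSpace Ω'] {τ : Measure Ω} {τ' : Measure Ω'} [SFinite τ] [SFinite τ']
    {F : Ω → S → ℝ} {F' : Ω' → S → ℝ}
    (hF : Measurable (Function.uncurry F)) (hb : ∀ ω x, |F ω x| ≤ 1)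
    (hF' : Measurable (Function.uncurry F')) (hb' : ∀ ω x, |F' ω x| ≤ 1) {κ κ' : ℝ≥0∞}
    (hκ : ∀ x y, ∫⁻ ω, ENNReal.ofReal ((F ω x - F ω y) ^ 2) ∂τ = κ * edist x y)
    (hκ' : ∀ x y, ∫⁻ ω, ENNReal.ofReal ((F' ω x - F' ω y) ^ 2) ∂τ' = κ' * edist x y)
    (hκt : κ ≠ ∞) (hκt' : κ' ≠ ∞)
    {m₁ m₂ : Measure S} [IsFiniteMeasure m₁] [IsFiniteMeasure m₂]
    (hm : m₁ Set.univ = m₂ Set.univ) :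
    κ' * ∫⁻ ω, ENNReal.ofReal ((∫ x, F ω x ∂m₁ - ∫ x, F ω x ∂m₂) ^ 2) ∂τ =
      κ * ∫⁻ ω, ENNReal.ofReal ((∫ x, F' ω x ∂m₁ - ∫ x, F' ω x ∂m₂) ^ 2) ∂τ' := by
  have h := lintegral_sq_integral_sub_add hF hb hκ hm
  have h' := lintegral_sq_integral_sub_add hF' hb' hκ' hm
  simp only [lintegral_const_mul' _ _ hκt, ← mul_add] at h
  simp only [lintegral_const_mul' _ _ hκt', ← mul_add] at h'
  set A := ∫⁻ x, ∫⁻ y, edist x y ∂m₁ ∂m₁ + ∫⁻ x, ∫⁻ y, edist x y ∂m₂ ∂m₂ with hA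
  have hfin : ∀ (m : Measure S) [IsFiniteMeasure m], ∫⁻ x, ∫⁻ y, edist x y ∂m ∂m ≠ ∞ := by
    intro m _
    have hd : ediam (Set.univ : Set S) ≠ ∞ :=
      (isBounded_iff_ediam_ne_top).1 (Bornology.IsBounded.all _)
    refine ne_top_of_le_ne_top ?_ (lintegral_mono fun x => lintegral_mono fun y =>
      edist_le_ediam_of_mem (Set.mem_univ x) (Set.mem_univ y))
    simp only [lintegral_const]
    exact ENNReal.mul_ne_top (ENNReal.mul_ne_top hd (measure_ne_top _ _)) (measure_ne_top _ _)
  have hAt : κ' * (κ * A) ≠ ∞ :=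
    ENNReal.mul_ne_top hκt' (ENNReal.mul_ne_top hκt (ENNReal.add_ne_top.2 ⟨hfin m₁, hfin m₂⟩))
  have e : 2 * (κ' * ∫⁻ ω, ENNReal.ofReal ((∫ x, F ω x ∂m₁ - ∫ x, F ω x ∂m₂) ^ 2) ∂τ) +
      κ' * (κ * A) = 2 * (κ * ∫⁻ ω, ENNReal.ofReal ((∫ x, F' ω x ∂m₁ - ∫ x, F' ω x ∂m₂) ^ 2) ∂τ') +
      κ' * (κ * A) := by
    calc _ = κ' * (2 * (∫⁻ ω, ENNReal.ofReal ((∫ x, F ω x ∂m₁ - ∫ x, F ω x ∂m₂) ^ 2) ∂τ) +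
          κ * A) := by ring
      _ = κ * (2 * (∫⁻ ω, ENNReal.ofReal ((∫ x, F' ω x ∂m₁ - ∫ x, F' ω x ∂m₂) ^ 2) ∂τ') +
          κ' * A) := by
        rw [h, h']
        ring
      _ = _ := by ring
  exact (ENNReal.mul_right_inj two_ne_zero (by simp)).1 ((ENNReal.add_left_inj hAt).1 e)

end Energy

section Caps

variable {d : ℕ}

open scoped ENNReal

/-- The kernel of the cap discrepancy: the indicator function of the cap of height `ω.1` centred
at `ω.2`. -/
def capKernel (ω : ℝ × Sph d) (x : Sph d) : ℝ :=
  (sphCap ω.2 ω.1).indicator (fun _ => (1 : ℝ)) x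

/-- The measure on the space of caps. -/
def capMeasure (d : ℕ) : Measure (ℝ × Sph d) :=
  (volume.restrict (Set.Icc (-1 : ℝ) 1)).prod (sigmaSph d)

instance : IsFiniteMeasure (capMeasure d) := by
  unfold capMeasure
  infer_instance

lemma capKernel_apply (ω : ℝ × Sph d) (x : Sph d) :
    capKernel ω x = if ω.1 ≤ ⟪(ω.2 : Amb d), (x : Amb d)⟫ then 1 else 0 := by
  simp [capKernel, sphCap, Set.indicator_apply]

lemma abs_capKernel_le_one (ω : ℝ × Sph d) (x : Sph d) : |capKernel ω x| ≤ 1 := by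
  rw [capKernel_apply]
  split_ifs <;> simp

lemma measurable_capKernel : Measurable (Function.uncurry (capKernel (d := d))) := by
  have : Function.uncurry (capKernel (d := d)) = fun p =>
      if p.1.1 ≤ ⟪(p.1.2 : Amb d), (p.2 : Amb d)⟫ then 1 else 0 := by
    ext p
    exact capKernel_apply _ _
  rw [this]
  refine Measurable.ite ?_ measurable_const measurable_const
  exact (isClosed_le (by fun_prop) (by fun_prop)).measurableSet

lemma measurableSet_sphCap (z : Sph d) (t : ℝ) : MeasurableSet (sphCap z t) :=
  (isClosed_le (by fun_prop) (by fun_prop)).measurableSet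

lemma integral_capKernel (ω : ℝ × Sph d) :
    ∫ x, capKernel ω x ∂(sigmaSph d) = (sigmaSph d (sphCap ω.2 ω.1)).toReal := by
  unfold capKernel
  rw [integral_indicator (measurableSet_sphCap _ _)]
  simp [measureReal_def]

lemma sigmaSph_sphCap_eq (z z' : Sph d) (t : ℝ) :
    sigmaSph d (sphCap z t) = sigmaSph d (sphCap z' t) := by
  obtain ⟨L, hL⟩ := exists_isometry_map_eq (u := (z : Amb d)) (v := z') (by simp)
  rw [← (measurePreserving_sphMap L).measure_preimage
    (measurableSet_sphCap z' t).nullMeasurableSet]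
  congr 1
  ext y
  simp [sphCap, coe_sphMap, ← hL]

lemma integral_capKernel_center (t : ℝ) (x z : Sph d) :
    ∫ z, capKernel (t, z) x ∂(sigmaSph d) = (sigmaSph d (sphCap z t)).toReal := by
  rw [sigmaSph_sphCap_eq z x, ← integral_capKernel (t, x)]
  simp only [capKernel_apply, real_inner_comm]

lemma half_le_sigmaSph_sphCap (z : Sph d) {t : ℝ} (ht : t ≤ 0) :
    1 / 2 ≤ (sigmaSph d (sphCap z t)).toReal := by
  have hz : -(z : Amb d) ∈ sphere (0 : Amb d) 1 := by simp
  have hun : sphCap z 0 ∪ sphCap ⟨-z, hz⟩ 0 = Set.univ := by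
    ext y
    simp only [sphCap, Set.mem_union, Set.mem_ofPred_eq, inner_neg_left, Set.mem_univ, iff_true]
    rcases le_total 0 ⟪(z : Amb d), (y : Amb d)⟫ with h | h
    · exact .inl h
    · exact .inr (by linarith)
  have h1 : 1 ≤ (sigmaSph d).real (sphCap z 0) + (sigmaSph d).real (sphCap ⟨-z, hz⟩ 0) := by
    refine le_trans ?_ (measureReal_union_le _ _)
    rw [hun]
    simp
  have h2 : (sigmaSph d).real (sphCap ⟨-z, hz⟩ 0) = (sigmaSph d).real (sphCap z 0) := by
    simp only [measureReal_def, sigmaSph_sphCap_eq _ z]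
  have h3 : (sigmaSph d).real (sphCap z 0) ≤ (sigmaSph d).real (sphCap z t) :=
    measureReal_mono fun y hy => ht.trans hy
  rw [← measureReal_def]
  linarith

lemma inner_mem_Icc (x y : Sph d) : ⟪(x : Amb d), (y : Amb d)⟫ ∈ Set.Icc (-1 : ℝ) 1 := by
  have := abs_real_inner_le_norm (x : Amb d) y
  simp only [norm_eq_of_mem_sphere, mul_one] at this
  exact abs_le.1 this

/-- The first absolute moment of a coordinate on the sphere. -/
def capConst (d : ℕ) : ℝ≥0∞ :=
  ∫⁻ z : Sph d, ENNReal.ofReal |⟪(z : Amb d), EuclideanSpace.single 0 1⟫| ∂(sigmaSph d)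

lemma lintegral_abs_inner (v : Amb d) :
    ∫⁻ z : Sph d, ENNReal.ofReal |⟪(z : Amb d), v⟫| ∂(sigmaSph d) =
      capConst d * ENNReal.ofReal ‖v‖ := by
  obtain ⟨L, hL⟩ := exists_isometry_map_eq
    (u := ‖v‖ • (EuclideanSpace.single 0 1 : Amb d)) (v := v) (by simp [norm_smul])
  rw [← (measurePreserving_sphMap L).lintegral_comp (by fun_prop), capConst,
    ← lintegral_mul_const' _ _ ENNReal.ofReal_ne_top]
  refine lintegral_congr fun z => ?_
  rw [← ENNReal.ofReal_mul (abs_nonneg _)]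
  congr 1
  conv_lhs => rw [← hL, coe_sphMap, L.inner_map_map, real_inner_smul_right, abs_mul, abs_norm,
    mul_comm]

lemma capConst_ne_top : capConst d ≠ ∞ := by
  refine ne_top_of_le_ne_top ENNReal.one_ne_top ?_
  calc capConst d ≤ ∫⁻ z : Sph d, 1 ∂(sigmaSph d) := lintegral_mono fun z => by
        rw [← ENNReal.ofReal_one]
        apply ENNReal.ofReal_le_ofReal
        refine (abs_real_inner_le_norm _ _).trans ?_
        simp
    _ = 1 := by simp

lemma capConst_ne_zero : capConst d ≠ 0 := by
  intro h0
  have h1 : (1 : ℝ≥0∞) ≤ ∫⁻ z : Sph d, ∑ i, ENNReal.ofReal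
      |⟪(z : Amb d), EuclideanSpace.single i 1⟫| ∂(sigmaSph d) := by
    calc (1 : ℝ≥0∞) = ∫⁻ z : Sph d, 1 ∂(sigmaSph d) := by simp
      _ ≤ _ := lintegral_mono fun z => by
        rw [← ENNReal.ofReal_sum_of_nonneg fun _ _ => abs_nonneg _, ← ENNReal.ofReal_one]
        apply ENNReal.ofReal_le_ofReal
        have hz : ‖(z : Amb d)‖ ^ 2 = 1 := by simp
        rw [EuclideanSpace.norm_sq_eq] at hz
        refine hz.symm.le.trans ?_
        refine Finset.sum_le_sum fun i _ => ?_
        have h2 := PiLp.norm_apply_le (z : Amb d) i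
        simp only [norm_eq_of_mem_sphere] at h2
        simp only [EuclideanSpace.inner_single_right, one_mul]
        simp only [Real.norm_eq_abs, conj_trivial] at h2 ⊢
        nlinarith [abs_nonneg ((z : Amb d) i)]
  rw [lintegral_finsetSum _ (fun i _ => by fun_prop)] at h1
  simp [lintegral_abs_inner, h0] at h1

lemma lintegral_step_sub_sq {a b : ℝ} (ha : a ∈ Set.Icc (-1 : ℝ) 1) (hb : b ∈ Set.Icc (-1 : ℝ) 1) :
    ∫⁻ t in Set.Icc (-1 : ℝ) 1, ENNReal.ofReal
      (((if t ≤ a then 1 else 0) - (if t ≤ b then 1 else 0)) ^ 2) = ENNReal.ofReal |a - b| := by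
  wlog hab : b ≤ a generalizing a b
  · rw [abs_sub_comm, ← this hb ha (le_of_not_ge hab)]
    simp only [sub_sq_comm]
  have h1 : ∀ t : ℝ, ENNReal.ofReal
      (((if t ≤ a then 1 else 0) - (if t ≤ b then 1 else 0)) ^ 2) =
      (Set.Ioc b a).indicator 1 t := by
    intro t
    by_cases h1 : t ≤ b
    · simp [h1, h1.trans hab]
    · by_cases h2 : t ≤ a <;> simp [h1, h2, not_le.1 h1]
  simp only [h1]
  rw [lintegral_indicator_one measurableSet_Ioc, Measure.restrict_apply measurableSet_Ioc,
    Set.inter_eq_left.2, Real.volume_Ioc, abs_of_nonneg (by linarith)]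
  exact fun t ht => ⟨by linarith [hb.1, ht.1], ht.2.trans ha.2⟩

lemma lintegral_capKernel_sub_sq (x y : Sph d) :
    ∫⁻ ω, ENNReal.ofReal ((capKernel ω x - capKernel ω y) ^ 2) ∂(capMeasure d) =
      capConst d * edist x y := by
  have hm : Measurable fun ω : ℝ × Sph d =>
      ENNReal.ofReal ((capKernel ω x - capKernel ω y) ^ 2) := by
    have h : ∀ x : Sph d, Measurable fun ω : ℝ × Sph d => capKernel ω x := fun x =>
      measurable_capKernel.comp (measurable_id.prodMk measurable_const)
    exact (((h x).sub (h y)).pow_const 2).ennreal_ofReal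
  rw [capMeasure, lintegral_prod_symm _ hm.aemeasurable]
  have h2 : ∀ z : Sph d, ∫⁻ t in Set.Icc (-1 : ℝ) 1,
      ENNReal.ofReal ((capKernel (t, z) x - capKernel (t, z) y) ^ 2) =
      ENNReal.ofReal |⟪(z : Amb d), (x - y : Amb d)⟫| := fun z => by
    simp only [capKernel_apply]
    rw [lintegral_step_sub_sq (inner_mem_Icc z x) (inner_mem_Icc z y), inner_sub_right]
  simp only [h2]
  rw [lintegral_abs_inner, edist_dist, Subtype.dist_eq, dist_eq_norm]

variable {n : ℕ}

/-- The squared discrepancy as a nonnegative extended real. -/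
lemma ofReal_sphDisc_sq (x : Fin n → Sph d) (w : Fin n → ℝ) :
    ENNReal.ofReal (sphDisc x w ^ 2) = ∫⁻ t in Set.Icc (-1 : ℝ) 1, ∫⁻ z, ENNReal.ofReal
      ((∑ j, w j * capKernel (t, z) (x j) - (sigmaSph d (sphCap z t)).toReal) ^ 2)
        ∂(sigmaSph d) := by
  set G : ℝ × Sph d → ℝ := fun ω =>
    ∑ j, w j * capKernel ω (x j) - (sigmaSph d (sphCap ω.2 ω.1)).toReal with hG
  have hGm : Measurable G := by
    simp only [hG, ← integral_capKernel]
    refine Measurable.sub (Finset.measurable_sum _ fun j _ => measurable_const.mul ?_) ?_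
    · exact measurable_capKernel.comp (measurable_id.prodMk measurable_const)
    · exact (measurable_capKernel.stronglyMeasurable.integral_prod_right).measurable
  have hGb : ∀ ω, |G ω| ≤ ∑ j, |w j| + 1 := fun ω => by
    refine (abs_sub _ _).trans (add_le_add ((Finset.abs_sum_le_sum_abs _ _).trans ?_) ?_)
    · refine Finset.sum_le_sum fun j _ => ?_
      rw [abs_mul]
      exact mul_le_of_le_one_right (abs_nonneg _) (abs_capKernel_le_one _ _)
    · rw [abs_of_nonneg ENNReal.toReal_nonneg, ← measureReal_def]
      exact measureReal_le_one
  have hi : Integrable (fun ω => G ω ^ 2) (capMeasure d) := by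
    refine Integrable.of_bound (hGm.pow_const 2).aestronglyMeasurable ((∑ j, |w j| + 1) ^ 2)
      (.of_forall fun ω => ?_)
    rw [norm_pow, Real.norm_eq_abs]
    exact pow_le_pow_left₀ (abs_nonneg _) (hGb ω) 2
  have h1 : sphDisc x w ^ 2 = ∫ ω, G ω ^ 2 ∂(capMeasure d) := by
    rw [sphDisc, Real.sq_sqrt (integral_nonneg fun _ => integral_nonneg fun _ => sq_nonneg _),
      capMeasure, integral_prod _ hi]
    rfl
  rw [h1, ofReal_integral_eq_lintegral_ofReal hi (.of_forall fun _ => sq_nonneg _), capMeasure,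
    lintegral_prod _ (hGm.pow_const 2).ennreal_ofReal.aemeasurable]

/-- The squared discrepancy is the sum of the squared discrepancy of a neutral charge and of the
contribution of the total weight. -/
lemma lintegral_sq_sum_capKernel_sub (x : Fin n → Sph d) (w : Fin n → ℝ) (t : ℝ) (z₀ : Sph d) :
    ∫⁻ z, ENNReal.ofReal
      ((∑ j, w j * capKernel (t, z) (x j) - (sigmaSph d (sphCap z t)).toReal) ^ 2) ∂(sigmaSph d) =
    ∫⁻ z, ENNReal.ofReal ((∑ j, w j * capKernel (t, z) (x j) -
        (∑ j, w j) * ∫ y, capKernel (t, z) y ∂(sigmaSph d)) ^ 2) ∂(sigmaSph d) +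
      ENNReal.ofReal (((∑ j, w j - 1) * (sigmaSph d (sphCap z₀ t)).toReal) ^ 2) := by
  simp only [integral_capKernel, sigmaSph_sphCap_eq _ z₀]
  set s := (sigmaSph d (sphCap z₀ t)).toReal with hs
  set W := ∑ j, w j with hW
  have him : ∀ x, Measurable fun z : Sph d => capKernel (t, z) x := fun x =>
    measurable_capKernel.comp ((measurable_const.prodMk measurable_id).prodMk measurable_const)
  have hik : ∀ x, Integrable (fun z : Sph d => capKernel (t, z) x) (sigmaSph d) := fun x =>
    integrable_of_forall_abs_le_one (him x) fun z => abs_capKernel_le_one _ _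
  set G : Sph d → ℝ := fun z => ∑ j, w j * capKernel (t, z) (x j) - W * s with hG
  have hGi : Integrable G (sigmaSph d) :=
    (integrable_finsetSum _ fun j _ => (hik _).const_mul _).sub (integrable_const _)
  have hG0 : ∫ z, G z ∂(sigmaSph d) = 0 := by
    rw [hG, integral_sub (integrable_finsetSum _ fun j _ => (hik _).const_mul _)
      (integrable_const _), integral_finsetSum _ (fun j _ => (hik _).const_mul _)]
    simp only [integral_const_mul, integral_capKernel_center t _ z₀, ← hs, integral_const,
      probReal_univ, one_smul, ← Finset.sum_mul, ← hW, sub_self]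
  have hGm : Measurable G :=
    (Finset.measurable_sum _ fun j _ => measurable_const.mul (him _)).sub measurable_const
  have hG2 : Integrable (fun z => G z ^ 2) (sigmaSph d) := by
    refine Integrable.of_bound (hGm.pow_const 2).aestronglyMeasurable ((∑ j, |w j| + |W * s|) ^ 2)
      (.of_forall fun z => ?_)
    rw [norm_pow, Real.norm_eq_abs]
    refine pow_le_pow_left₀ (abs_nonneg _) ?_ 2
    refine (abs_sub _ _).trans (add_le_add ((Finset.abs_sum_le_sum_abs _ _).trans ?_) le_rfl)
    refine Finset.sum_le_sum fun j _ => ?_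
    rw [abs_mul]
    exact mul_le_of_le_one_right (abs_nonneg _) (abs_capKernel_le_one _ _)
  have h1 : ∀ z, (∑ j, w j * capKernel (t, z) (x j) - s) ^ 2 =
      G z ^ 2 + 2 * ((W - 1) * s) * G z + ((W - 1) * s) ^ 2 := fun z => by
    simp only [hG]
    ring
  have hi1 : Integrable (fun z => G z ^ 2 + 2 * ((W - 1) * s) * G z) (sigmaSph d) :=
    hG2.add (hGi.const_mul _)
  have hi2 : Integrable (fun z => (∑ j, w j * capKernel (t, z) (x j) - s) ^ 2) (sigmaSph d) := by
    simp only [h1]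
    exact hi1.add (integrable_const _)
  rw [← ofReal_integral_eq_lintegral_ofReal hi2 (.of_forall fun _ => sq_nonneg _),
    ← ofReal_integral_eq_lintegral_ofReal hG2 (.of_forall fun _ => sq_nonneg _),
    ← ENNReal.ofReal_add (integral_nonneg fun _ => sq_nonneg _) (sq_nonneg _)]
  congr 1
  simp only [h1]
  rw [integral_add hi1 (integrable_const _), integral_add hG2 (hGi.const_mul _),
    integral_const_mul, hG0]
  simp

end Caps

section Bumps

variable {d : ℕ}

open scoped ENNReal

/-- The truncated power profile. -/
def profile (m : ℕ) (s : ℝ) : ℝ := max 0 (1 - s) ^ m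

lemma profile_nonneg (m : ℕ) (s : ℝ) : 0 ≤ profile m s := by unfold profile; positivity

lemma profile_le_one (m : ℕ) {s : ℝ} (hs : 0 ≤ s) : profile m s ≤ 1 :=
  pow_le_one₀ (le_max_left _ _) (max_le zero_le_one (by linarith))

lemma profile_eq_zero {m : ℕ} (hm : m ≠ 0) {s : ℝ} (hs : 1 ≤ s) : profile m s = 0 := by
  rw [profile, max_eq_left (by linarith), zero_pow hm]

lemma profile_of_le_one (m : ℕ) {s : ℝ} (hs : s ≤ 1) : profile m s = (1 - s) ^ m := by
  rw [profile, max_eq_right (by linarith)]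

/-- The bump function on the ambient space with support in the unit ball. -/
def bump (v : Amb d) : ℝ := profile (d + 1) (‖v‖ ^ 2)

lemma continuous_bump : Continuous (bump (d := d)) := by
  unfold bump profile
  fun_prop

lemma bump_nonneg (v : Amb d) : 0 ≤ bump v := profile_nonneg _ _

lemma bump_le_one (v : Amb d) : bump v ≤ 1 := profile_le_one _ (sq_nonneg _)

lemma bump_eq_zero {v : Amb d} (hv : 1 ≤ ‖v‖) : bump v = 0 :=
  profile_eq_zero (by simp) (by nlinarith)

lemma bump_ge {v : Amb d} (hv : ‖v‖ ≤ 3 / 4) : (1 / 4 : ℝ) ^ (d + 1) ≤ bump v := by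
  rw [bump, profile_of_le_one _ (by nlinarith [norm_nonneg v])]
  exact pow_le_pow_left₀ (by norm_num) (by nlinarith [norm_nonneg v]) _

lemma bump_lipschitz (v w : Amb d) : |bump v - bump w| ≤ 2 * (d + 1) * ‖v - w‖ := by
  have h := abs_pow_sub_pow_le (max 0 (1 - ‖v‖ ^ 2)) (max 0 (1 - ‖w‖ ^ 2)) (d + 1)
  have hle : ∀ z : Amb d, |max 0 (1 - ‖z‖ ^ 2)| ≤ 1 := fun z => by
    rw [abs_of_nonneg (le_max_left _ _)]
    exact max_le zero_le_one (by nlinarith [norm_nonneg z])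
  have h1 : |max 0 (1 - ‖v‖ ^ 2) - max 0 (1 - ‖w‖ ^ 2)| ≤ 2 * ‖v - w‖ := by
    clear h
    wlog hvw : ‖v‖ ≤ ‖w‖ generalizing v w
    · rw [abs_sub_comm, norm_sub_rev]
      exact this w v (le_of_not_ge hvw)
    have h2 : ‖w‖ - ‖v‖ ≤ ‖v - w‖ := by
      rw [norm_sub_rev]
      exact norm_sub_norm_le _ _
    have h0 := norm_nonneg v
    rw [abs_of_nonneg (sub_nonneg.2 (max_le_max le_rfl (by nlinarith)))]
    rcases le_total ‖w‖ 1 with h3 | h3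
    · rw [max_eq_right (by nlinarith), max_eq_right (by nlinarith)]
      nlinarith
    · rw [max_eq_left (a := 0) (b := 1 - ‖w‖ ^ 2) (by nlinarith)]
      rcases le_total ‖v‖ 1 with h4 | h4
      · rw [max_eq_right (by nlinarith)]
        nlinarith
      · rw [max_eq_left (by nlinarith)]
        simp
  refine h.trans ?_
  have h3 : (max |max 0 (1 - ‖v‖ ^ 2)| |max 0 (1 - ‖w‖ ^ 2)|) ^ (d + 1 - 1) ≤ 1 :=
    pow_le_one₀ ((abs_nonneg _).trans (le_max_left _ _)) (max_le (hle v) (hle w))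
  calc _ ≤ (2 * ‖v - w‖) * ((d + 1 : ℕ) : ℝ) * 1 := by gcongr
    _ = _ := by push_cast; ring

/-- The squared `L²` modulus of continuity of the bump function. -/
def bumpModulus (h : Amb d) : ℝ≥0∞ := ∫⁻ u : Amb d, ENNReal.ofReal ((bump u - bump (u + h)) ^ 2)

lemma bumpModulus_eq_of_norm_eq {h h' : Amb d} (hh : ‖h‖ = ‖h'‖) :
    bumpModulus h = bumpModulus h' := by
  obtain ⟨L, rfl⟩ := exists_isometry_map_eq hh
  unfold bumpModulus
  rw [← L.measurePreserving.lintegral_comp_emb L.toHomeomorph.measurableEmbedding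
    (fun u => ENNReal.ofReal ((bump u - bump (u + L h)) ^ 2))]
  simp only [← map_add, bump, LinearIsometryEquiv.norm_map]

lemma bumpModulus_le (h : Amb d) :
    bumpModulus h ≤ ENNReal.ofReal (min 1 ((2 * (d + 1) * ‖h‖) ^ 2)) *
      (2 * volume (ball (0 : Amb d) 1)) := by
  have h1 : ∀ u : Amb d, ENNReal.ofReal ((bump u - bump (u + h)) ^ 2) ≤
      ENNReal.ofReal (min 1 ((2 * (d + 1) * ‖h‖) ^ 2)) *
        ((ball (0 : Amb d) 1).indicator 1 u + (ball (0 : Amb d) 1).indicator 1 (u + h)) := by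
    intro u
    have h2 : (bump u - bump (u + h)) ^ 2 ≤ min 1 ((2 * (d + 1) * ‖h‖) ^ 2) := by
      rw [← sq_abs]
      refine le_min ?_ ?_
      · refine pow_le_one₀ (abs_nonneg _) (abs_le.2 ⟨?_, ?_⟩)
        · linarith [bump_nonneg u, bump_le_one (u + h)]
        · linarith [bump_nonneg (u + h), bump_le_one u]
      · refine pow_le_pow_left₀ (abs_nonneg _) ?_ 2
        simpa using bump_lipschitz u (u + h)
    by_cases hu : ‖u‖ < 1
    · rw [Set.indicator_of_mem (by simpa using hu)]
      calc _ ≤ ENNReal.ofReal (min 1 ((2 * (d + 1) * ‖h‖) ^ 2)) * 1 := by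
            rw [mul_one]; exact ENNReal.ofReal_le_ofReal h2
        _ ≤ _ := by gcongr; exact le_self_add
    · by_cases hu' : ‖u + h‖ < 1
      · rw [Set.indicator_of_mem (a := u + h) (by simpa using hu')]
        calc _ ≤ ENNReal.ofReal (min 1 ((2 * (d + 1) * ‖h‖) ^ 2)) * 1 := by
              rw [mul_one]; exact ENNReal.ofReal_le_ofReal h2
          _ ≤ _ := by gcongr; exact le_add_self
      · simp [bump_eq_zero (not_lt.1 hu), bump_eq_zero (not_lt.1 hu')]
  refine (lintegral_mono h1).trans ?_
  have hm : Measurable ((ball (0 : Amb d) 1).indicator (1 : Amb d → ℝ≥0∞)) :=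
    measurable_one.indicator measurableSet_ball
  rw [lintegral_const_mul' _ _ ENNReal.ofReal_ne_top, lintegral_add_left hm,
    lintegral_add_right_eq_self (fun u => (ball (0 : Amb d) 1).indicator (1 : Amb d → ℝ≥0∞) u) h,
    lintegral_indicator_one measurableSet_ball, two_mul (volume _)]

lemma bumpModulus_ge {h : Amb d} (hh : 2 ≤ ‖h‖) :
    ENNReal.ofReal (((1 / 4 : ℝ) ^ (d + 1)) ^ 2) * volume (ball (0 : Amb d) (3 / 4)) ≤
      bumpModulus h := by
  rw [← setLIntegral_const]
  refine (setLIntegral_mono' measurableSet_ball fun u hu => ?_).trans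
    (setLIntegral_le_lintegral _ _)
  rw [mem_ball_zero_iff] at hu
  have h1 : 1 ≤ ‖u + h‖ := by
    have := norm_sub_norm_le h (-u)
    rw [norm_neg, sub_neg_eq_add, add_comm h u] at this
    linarith
  rw [bump_eq_zero h1, sub_zero]
  exact ENNReal.ofReal_le_ofReal (pow_le_pow_left₀ (by positivity) (bump_ge hu.le) 2)

/-- The kernel made of translates and dilates of the bump function. -/
def ballKernel (ω : ℝ × Amb d) (x : Sph d) : ℝ := bump (ω.1⁻¹ • (ω.2 - (x : Amb d)))

/-- The measure on the space of balls. -/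
def ballMeasure (d : ℕ) : Measure (ℝ × Amb d) :=
  ((volume.restrict (Set.Ioi (0 : ℝ))).withDensity
    (fun r => ENNReal.ofReal ((r ^ (d + 1))⁻¹))).prod volume

instance : SFinite (ballMeasure d) := by
  unfold ballMeasure
  infer_instance

lemma ballKernel_nonneg (ω : ℝ × Amb d) (x : Sph d) : 0 ≤ ballKernel ω x := bump_nonneg _

lemma ballKernel_le_one (ω : ℝ × Amb d) (x : Sph d) : ballKernel ω x ≤ 1 := bump_le_one _

lemma abs_ballKernel_le_one (ω : ℝ × Amb d) (x : Sph d) : |ballKernel ω x| ≤ 1 := by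
  rw [abs_of_nonneg (ballKernel_nonneg _ _)]
  exact ballKernel_le_one _ _

lemma measurable_ballKernel : Measurable (Function.uncurry (ballKernel (d := d))) := by
  have : Function.uncurry (ballKernel (d := d)) =
      fun p => bump (p.1.1⁻¹ • (p.1.2 - (p.2 : Amb d))) :=
    rfl
  rw [this]
  exact continuous_bump.measurable.comp (by fun_prop)

lemma continuous_ballKernel (ω : ℝ × Amb d) : Continuous (ballKernel ω) := by
  unfold ballKernel
  exact continuous_bump.comp (by fun_prop)

lemma lintegral_ballMeasure {G : ℝ × Amb d → ℝ≥0∞} (hG : Measurable G) :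
    ∫⁻ ω, G ω ∂ballMeasure d =
      ∫⁻ r in Set.Ioi (0 : ℝ), ENNReal.ofReal ((r ^ (d + 1))⁻¹) * ∫⁻ u, G (r, u) := by
  rw [ballMeasure, lintegral_prod _ hG.aemeasurable, lintegral_withDensity_eq_lintegral_mul _
    (by fun_prop) hG.lintegral_prod_right']
  rfl

lemma lintegral_comp_inv_smul_sub {f : Amb d → ℝ≥0∞} (hf : Measurable f) {r : ℝ} (hr : 0 < r)
    (x : Amb d) :
    ∫⁻ u, f (r⁻¹ • (u - x)) = ENNReal.ofReal (r ^ (d + 1)) * ∫⁻ u, f u := by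
  rw [lintegral_sub_right_eq_self (fun u => f (r⁻¹ • u)) x,
    ← lintegral_map hf (measurable_const_smul _),
    Measure.map_addHaar_smul _ (inv_ne_zero hr.ne'), lintegral_smul_measure,
    finrank_euclideanSpace_fin, smul_eq_mul, inv_pow, inv_inv, abs_of_pos (by positivity)]

lemma norm_single_one : ‖(EuclideanSpace.single 0 1 : Amb d)‖ = 1 := by simp

/-- The constant of proportionality between the ball kernel energy and the distance. -/
def ballConst (d : ℕ) : ℝ≥0∞ :=
  ∫⁻ s in Set.Ioi (0 : ℝ), bumpModulus (s⁻¹ • (EuclideanSpace.single 0 1 : Amb d))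

lemma lintegral_Ioi_comp_mul {f : ℝ → ℝ≥0∞} (hf : Measurable f) {a : ℝ} (ha : 0 < a) :
    ∫⁻ r in Set.Ioi (0 : ℝ), f r = ENNReal.ofReal a * ∫⁻ s in Set.Ioi (0 : ℝ), f (a * s) := by
  rw [← lintegral_indicator measurableSet_Ioi, ← lintegral_indicator measurableSet_Ioi]
  nth_rw 1 [← Real.smul_map_volume_mul_left ha.ne']
  rw [lintegral_smul_measure, lintegral_map (hf.indicator measurableSet_Ioi)
    (measurable_const_mul _), abs_of_pos ha, smul_eq_mul]
  congr 2
  ext s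
  simp [Set.indicator_apply, ha]

lemma measurable_bumpModulus : Measurable (bumpModulus (d := d)) := by
  unfold bumpModulus
  refine Measurable.lintegral_prod_right'
    (f := fun p : Amb d × Amb d => ENNReal.ofReal ((bump p.2 - bump (p.2 + p.1)) ^ 2)) ?_
  have := (continuous_bump (d := d)).measurable
  fun_prop

lemma lintegral_ballKernel_sub_sq (x y : Sph d) :
    ∫⁻ ω, ENNReal.ofReal ((ballKernel ω x - ballKernel ω y) ^ 2) ∂ballMeasure d =
      ballConst d * edist x y := by
  have hk := fun x : Sph d => (measurable_ballKernel (d := d)).comp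
    (measurable_id.prodMk (measurable_const (a := x)))
  have hk' : ∀ x : Sph d, Measurable fun ω => ballKernel ω x := hk
  rw [lintegral_ballMeasure (G := fun ω => ENNReal.ofReal ((ballKernel ω x - ballKernel ω y) ^ 2))
    (((hk' x).sub (hk' y)).pow_const 2).ennreal_ofReal]
  have h1 : ∀ r ∈ Set.Ioi (0 : ℝ), ENNReal.ofReal ((r ^ (d + 1))⁻¹) *
      ∫⁻ u, ENNReal.ofReal ((ballKernel (r, u) x - ballKernel (r, u) y) ^ 2) =
      bumpModulus (r⁻¹ • ((x : Amb d) - (y : Amb d))) := by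
    intro r hr
    have h2 : ∀ u : Amb d, (ballKernel (r, u) x - ballKernel (r, u) y) ^ 2 =
        (bump (r⁻¹ • (u - (x : Amb d))) -
          bump (r⁻¹ • (u - (x : Amb d)) + r⁻¹ • ((x : Amb d) - (y : Amb d)))) ^ 2 := by
      intro u
      rw [← smul_add, sub_add_sub_cancel]
      rfl
    have hb := (continuous_bump (d := d)).measurable
    simp only [h2]
    rw [lintegral_comp_inv_smul_sub (f := fun v => ENNReal.ofReal
      ((bump v - bump (v + r⁻¹ • ((x : Amb d) - (y : Amb d)))) ^ 2)) (by fun_prop) hr, ← mul_assoc,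
      ← ENNReal.ofReal_mul (by have := Set.mem_Ioi.1 hr; positivity), inv_mul_cancel₀
      (pow_ne_zero _ (ne_of_gt hr)), ENNReal.ofReal_one, one_mul]
    rfl
  rw [setLIntegral_congr_fun measurableSet_Ioi h1]
  rcases eq_or_ne x y with rfl | hxy
  · simp [bumpModulus]
  have hpos : 0 < dist x y := dist_pos.2 hxy
  have hbm := measurable_bumpModulus (d := d)
  rw [lintegral_Ioi_comp_mul (f := fun r => bumpModulus (r⁻¹ • ((x : Amb d) - (y : Amb d))))
    (by fun_prop) hpos, edist_dist,
    mul_comm]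
  congr 1
  refine setLIntegral_congr_fun measurableSet_Ioi fun s hs => bumpModulus_eq_of_norm_eq ?_
  rw [norm_smul, norm_smul, ← dist_eq_norm, ← Subtype.dist_eq, mul_inv, norm_mul, norm_inv,
    norm_inv, Real.norm_eq_abs, Real.norm_eq_abs, abs_of_pos hpos, norm_single_one]
  field_simp

lemma ballConst_ne_top : ballConst d ≠ ∞ := by
  have hV : 2 * volume (ball (0 : Amb d) 1) ≠ ∞ :=
    ENNReal.mul_ne_top (by simp) measure_ball_lt_top.ne
  have hle : ∀ s ∈ Set.Ioi (0 : ℝ), bumpModulus (s⁻¹ • (EuclideanSpace.single 0 1 : Amb d)) ≤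
      ENNReal.ofReal (min 1 ((2 * (d + 1) * s⁻¹) ^ 2)) * (2 * volume (ball (0 : Amb d) 1)) := by
    intro s hs
    have := bumpModulus_le (s⁻¹ • (EuclideanSpace.single 0 1 : Amb d))
    rwa [norm_smul, norm_inv, Real.norm_of_nonneg (le_of_lt hs), norm_single_one, mul_one] at this
  refine ne_top_of_le_ne_top ?_ (setLIntegral_mono' measurableSet_Ioi hle)
  rw [lintegral_mul_const' _ _ hV]
  refine ENNReal.mul_ne_top ?_ hV
  rw [← Set.Ioc_union_Ioi_eq_Ioi zero_le_one]
  refine ne_top_of_le_ne_top ?_ (lintegral_union_le _ _ _)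
  refine ENNReal.add_ne_top.2 ⟨?_, ?_⟩
  · refine ne_top_of_le_ne_top ?_ (lintegral_mono (g := fun _ => 1) fun s => ?_)
    · simp
    · rw [← ENNReal.ofReal_one]
      exact ENNReal.ofReal_le_ofReal (min_le_left _ _)
  · have hi := (integrableOn_Ioi_rpow_of_lt (a := -2) (by norm_num) zero_lt_one).const_mul
      ((2 * ((d : ℝ) + 1)) ^ 2)
    refine ne_top_of_le_ne_top hi.lintegral_lt_top.ne (setLIntegral_mono' measurableSet_Ioi
      fun s hs => ENNReal.ofReal_le_ofReal ((min_le_right _ _).trans (le_of_eq ?_)))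
    rw [Real.rpow_neg (zero_le_one.trans (le_of_lt hs)), mul_pow, inv_pow]
    norm_num

lemma ballConst_ne_zero : ballConst d ≠ 0 := by
  have h1 : ∫⁻ _s in Set.Ioc (0 : ℝ) (1 / 2), ENNReal.ofReal (((1 / 4 : ℝ) ^ (d + 1)) ^ 2) *
      volume (ball (0 : Amb d) (3 / 4)) ≤ ballConst d := by
    refine (setLIntegral_mono' measurableSet_Ioc fun s hs => ?_).trans
      (lintegral_mono_set Set.Ioc_subset_Ioi_self)
    refine bumpModulus_ge ?_
    rw [norm_smul, norm_inv, Real.norm_of_nonneg hs.1.le, norm_single_one, mul_one,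
      le_inv_comm₀ two_pos hs.1]
    linarith [hs.2]
  refine (lt_of_lt_of_le ?_ h1).ne'
  rw [setLIntegral_const]
  refine ENNReal.mul_pos (mul_ne_zero ?_ ?_) ?_
  · rw [Ne, ENNReal.ofReal_eq_zero, not_le]
    positivity
  · exact (measure_ball_pos _ _ (by norm_num)).ne'
  · simp

end Bumps

section Charges

variable {d n : ℕ}

open scoped ENNReal

/-- Half of a neutral charge: positive point masses compensated by a multiple of `σ`. -/
def halfCharge (x : Fin n → Sph d) (w : Fin n → ℝ) : Measure (Sph d) :=
  ∑ j, ENNReal.ofReal (w j) • Measure.dirac (x j) + ENNReal.ofReal (-∑ j, w j) • sigmaSph d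

instance (x : Fin n → Sph d) (w : Fin n → ℝ) : IsFiniteMeasure (halfCharge x w) := by
  refine ⟨?_⟩
  simp only [halfCharge, Measure.add_apply, Measure.finsetSum_apply, Measure.smul_apply,
    smul_eq_mul, measure_univ, mul_one]
  exact ENNReal.add_lt_top.2 ⟨ENNReal.sum_lt_top.2 fun _ _ => ENNReal.ofReal_lt_top,
    ENNReal.ofReal_lt_top⟩

lemma integral_halfCharge (x : Fin n → Sph d) (w : Fin n → ℝ) {f : Sph d → ℝ} (hf : Measurable f)
    (hb : ∀ y, |f y| ≤ 1) : ∫ y, f y ∂halfCharge x w =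
      ∑ j, max (w j) 0 * f (x j) + max (-∑ j, w j) 0 * ∫ y, f y ∂sigmaSph d := by
  have hi : ∀ (m : Measure (Sph d)) [IsFiniteMeasure m], Integrable f m := fun m _ =>
    Integrable.of_bound hf.aestronglyMeasurable 1 (.of_forall hb)
  have hj : ∀ j ∈ Finset.univ, Integrable f (ENNReal.ofReal (w j) • Measure.dirac (x j)) :=
    fun j _ => (hi _).smul_measure ENNReal.ofReal_ne_top
  rw [halfCharge, integral_add_measure (integrable_finsetSum_measure.2 hj)
    ((hi _).smul_measure ENNReal.ofReal_ne_top), integral_finsetSum_measure hj]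
  simp only [integral_smul_measure, integral_dirac, ENNReal.toReal_ofReal', smul_eq_mul]

lemma integral_halfCharge_sub (x : Fin n → Sph d) (w : Fin n → ℝ) {f : Sph d → ℝ}
    (hf : Measurable f) (hb : ∀ y, |f y| ≤ 1) :
    ∫ y, f y ∂halfCharge x w - ∫ y, f y ∂halfCharge x (-w) =
      ∑ j, w j * f (x j) - (∑ j, w j) * ∫ y, f y ∂sigmaSph d := by
  have h : ∀ a : ℝ, max a 0 - max (-a) 0 = a := fun a => by
    rcases le_total a 0 with h | h
    · rw [max_eq_right h, max_eq_left (by linarith)]; ring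
    · rw [max_eq_left h, max_eq_right (by linarith)]; ring
  have h2 : ∑ j, w j * f (x j) = ∑ j, max (w j) 0 * f (x j) - ∑ j, max (-w j) 0 * f (x j) := by
    rw [← Finset.sum_sub_distrib]
    exact Finset.sum_congr rfl fun j _ => by rw [← sub_mul, h]
  rw [integral_halfCharge x w hf hb, integral_halfCharge x (-w) hf hb, h2]
  simp only [Pi.neg_apply, Finset.sum_neg_distrib, neg_neg]
  have h3 := h (∑ j, w j)
  set A := max (∑ j, w j) 0
  set B := max (-∑ j, w j) 0
  rw [← h3]
  ring

lemma halfCharge_univ (x : Fin n → Sph d) (w : Fin n → ℝ) :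
    halfCharge x w Set.univ = halfCharge x (-w) Set.univ := by
  have h := integral_halfCharge_sub x w (f := fun _ => 1) measurable_const (by simp)
  simp only [integral_const, mul_one, smul_eq_mul, probReal_univ, sub_self, sub_eq_zero] at h
  exact (measureReal_eq_measureReal_iff).1 h

/-- The energy of the neutral charge `∑ w_j δ_{x_j} - (∑ w_j) σ` with respect to a kernel. -/
def chargeEnergy {Ω : Type*} [MeasurableSpace Ω] (τ : Measure Ω) (F : Ω → Sph d → ℝ)
    (x : Fin n → Sph d) (w : Fin n → ℝ) : ℝ≥0∞ :=
  ∫⁻ ω, ENNReal.ofReal ((∑ j, w j * F ω (x j) - (∑ j, w j) * ∫ y, F ω y ∂sigmaSph d) ^ 2) ∂τ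

lemma mul_chargeEnergy_cap (x : Fin n → Sph d) (w : Fin n → ℝ) :
    ballConst d * chargeEnergy (capMeasure d) capKernel x w =
      capConst d * chargeEnergy (ballMeasure d) ballKernel x w := by
  have h := mul_lintegral_sq_integral_sub_eq (S := Sph d) (measurable_capKernel (d := d))
    abs_capKernel_le_one (measurable_ballKernel (d := d)) abs_ballKernel_le_one
    lintegral_capKernel_sub_sq lintegral_ballKernel_sub_sq capConst_ne_top ballConst_ne_top
    (halfCharge_univ x w)
  have h1 : ∀ ω, ∫ y, capKernel ω y ∂halfCharge x w - ∫ y, capKernel ω y ∂halfCharge x (-w) = _ :=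
    fun ω => integral_halfCharge_sub x w (measurable_capKernel.comp measurable_prodMk_left)
      (abs_capKernel_le_one ω)
  have h2 : ∀ ω, ∫ y, ballKernel ω y ∂halfCharge x w - ∫ y, ballKernel ω y ∂halfCharge x (-w) = _ :=
    fun ω => integral_halfCharge_sub x w (continuous_ballKernel ω).measurable
      (abs_ballKernel_le_one ω)
  simp only [h1, h2] at h
  exact h

lemma measurable_charge {Ω : Type*} [MeasurableSpace Ω] {F : Ω → Sph d → ℝ}
    (hF : Measurable (Function.uncurry F)) (x : Fin n → Sph d) (w : Fin n → ℝ) :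
    Measurable fun ω => ∑ j, w j * F ω (x j) - (∑ j, w j) * ∫ y, F ω y ∂sigmaSph d := by
  refine Measurable.sub (Finset.measurable_sum _ fun j _ => measurable_const.mul
    (hF.comp (measurable_id.prodMk measurable_const))) (measurable_const.mul ?_)
  exact (hF.stronglyMeasurable.integral_prod_right').measurable

lemma ofReal_sphDisc_sq_eq (x : Fin n → Sph d) (w : Fin n → ℝ) (z₀ : Sph d) :
    ENNReal.ofReal (sphDisc x w ^ 2) = chargeEnergy (capMeasure d) capKernel x w +
      ∫⁻ t in Set.Icc (-1 : ℝ) 1,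
        ENNReal.ofReal ((((∑ j, w j) - 1) * (sigmaSph d (sphCap z₀ t)).toReal) ^ 2) := by
  have hm := ((measurable_charge measurable_capKernel x w).pow_const 2).ennreal_ofReal
  rw [ofReal_sphDisc_sq, chargeEnergy, capMeasure, lintegral_prod _ hm.aemeasurable,
    ← lintegral_add_left hm.lintegral_prod_right']
  refine lintegral_congr fun t => ?_
  exact lintegral_sq_sum_capKernel_sub x w t z₀

end Charges

section LowerBound

variable {d n : ℕ}

open scoped ENNReal

lemma integral_ballKernel_ge {r : ℝ} (hr : 0 < r) (hr1 : r ≤ 1) {u : Amb d} {y : Sph d}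
    (huy : dist u (y : Amb d) < r / 2) :
    (1 / 4 : ℝ) ^ (d + 1) * (((2 : ℝ) ^ d * (2 ^ (d + 1) + (d + 1)))⁻¹ * (r / 4) ^ d) ≤
      ∫ z, ballKernel (r, u) z ∂sigmaSph d := by
  have h1 := sigmaSph_ball_ge y (r := r / 4) (by positivity) (by linarith)
  rw [ENNReal.ofReal_le_iff_le_toReal (measure_ne_top _ _)] at h1
  have hi : Integrable (fun z => ballKernel (r, u) z) (sigmaSph d) :=
    Integrable.of_bound (continuous_ballKernel _).aestronglyMeasurable 1
      (.of_forall (abs_ballKernel_le_one _))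
  calc _ ≤ (1 / 4 : ℝ) ^ (d + 1) * (sigmaSph d (ball y (r / 4))).toReal := by gcongr
    _ = ∫ z in ball y (r / 4), (1 / 4 : ℝ) ^ (d + 1) ∂sigmaSph d := by
      rw [setIntegral_const, smul_eq_mul, mul_comm]
      rfl
    _ ≤ ∫ z in ball y (r / 4), ballKernel (r, u) z ∂sigmaSph d := by
      refine setIntegral_mono_on (integrable_const _) hi.integrableOn measurableSet_ball
        fun z hz => bump_ge ?_
      rw [norm_smul, norm_inv, Real.norm_of_nonneg hr.le, ← dist_eq_norm, inv_mul_le_iff₀ hr]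
      have h2 : dist (z : Amb d) y < r / 4 := hz
      have h3 := dist_triangle_right u (z : Amb d) y
      linarith
    _ ≤ _ := setIntegral_le_integral hi (.of_forall fun z => ballKernel_nonneg _ _)

lemma ballKernel_eq_zero {r : ℝ} (hr : 0 < r) {u : Amb d} {x : Sph d}
    (hux : r ≤ dist u (x : Amb d)) : ballKernel (r, u) x = 0 := by
  refine bump_eq_zero ?_
  rw [norm_smul, norm_inv, Real.norm_of_nonneg hr.le, ← dist_eq_norm, le_inv_mul_iff₀ hr]
  linarith

lemma sigmaSph_near_le (u : Amb d) {r : ℝ} (hr : 0 < r) :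
    sigmaSph d {y | dist u (y : Amb d) < r / 2} ≤ ENNReal.ofReal (2 ^ (d + 1) * r ^ d) := by
  rcases Set.eq_empty_or_nonempty {y : Sph d | dist u (y : Amb d) < r / 2} with h | ⟨y, hy⟩
  · simp [h]
  · refine (measure_mono fun z hz => ?_).trans (sigmaSph_ball_le y hr)
    have h1 := dist_triangle_left (z : Amb d) (y : Amb d) u
    rw [mem_ball, Subtype.dist_eq]
    simp only [Set.mem_ofPred_eq] at hy hz
    linarith

/-- The constant in the local lower bound for the energy of a neutral charge. -/
def gapConst (d : ℕ) : ℝ := ((1 / 4 : ℝ) ^ (d + 1) * (((2 : ℝ) ^ d * (2 ^ (d + 1) + (d + 1)))⁻¹ *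
  (1 / 4) ^ d)) ^ 2 / 2 ^ (d + 1)

lemma gapConst_pos : 0 < gapConst d := by unfold gapConst; positivity

lemma sigmaSph_gap_le_sq (x : Fin n → Sph d) (w : Fin n → ℝ) {δ : Sph d → ℝ}
    (hδ : ∀ y j, δ y ≤ dist y (x j)) {r : ℝ} (hr : 0 < r) (hr1 : r ≤ 1) (u : Amb d) :
    ENNReal.ofReal ((∑ j, w j) ^ 2 * gapConst d * r ^ d) *
        sigmaSph d {y | 2 * r ≤ δ y ∧ dist u (y : Amb d) < r / 2} ≤
      ENNReal.ofReal ((∑ j, w j * ballKernel (r, u) (x j) -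
        (∑ j, w j) * ∫ y, ballKernel (r, u) y ∂sigmaSph d) ^ 2) := by
  rcases Set.eq_empty_or_nonempty {y : Sph d | 2 * r ≤ δ y ∧ dist u (y : Amb d) < r / 2}
    with h | ⟨y, hy1, hy2⟩
  · simp [h]
  have hK := gapConst_pos (d := d)
  calc _ ≤ ENNReal.ofReal ((∑ j, w j) ^ 2 * gapConst d * r ^ d) *
        ENNReal.ofReal (2 ^ (d + 1) * r ^ d) := by
        gcongr
        exact (measure_mono fun z hz => hz.2).trans (sigmaSph_near_le u hr)
    _ = ENNReal.ofReal (((∑ j, w j) * ((1 / 4 : ℝ) ^ (d + 1) *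
        (((2 : ℝ) ^ d * (2 ^ (d + 1) + (d + 1)))⁻¹ * (r / 4) ^ d))) ^ 2) := by
        rw [← ENNReal.ofReal_mul (by positivity)]
        congr 1
        unfold gapConst
        rw [div_eq_mul_one_div r 4, mul_pow r (1 / 4) d]
        field_simp
    _ ≤ _ := by
        apply ENNReal.ofReal_le_ofReal
        have h0 : ∑ j, w j * ballKernel (r, u) (x j) = 0 := Finset.sum_eq_zero fun j _ => by
          rw [ballKernel_eq_zero hr, mul_zero]
          have h1 := dist_triangle_left (y : Amb d) (x j : Amb d) u
          have h2 := hδ y j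
          rw [Subtype.dist_eq] at h2
          linarith
        rw [h0, zero_sub, neg_sq, mul_pow (∑ j, w j), mul_pow (∑ j, w j)]
        exact mul_le_mul_of_nonneg_left (pow_le_pow_left₀ (by positivity)
          (integral_ballKernel_ge hr hr1 hy2) 2) (sq_nonneg _)

lemma lintegral_sigmaSph_gap {δ : Sph d → ℝ} (hδ : Measurable δ) {r : ℝ} (hr : 0 < r) :
    ∫⁻ u : Amb d, sigmaSph d {y | 2 * r ≤ δ y ∧ dist u (y : Amb d) < r / 2} =
      ENNReal.ofReal ((r / 2) ^ (d + 1)) * volume (ball (0 : Amb d) 1) *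
        sigmaSph d {y | 2 * r ≤ δ y} := by
  have hA : MeasurableSet {y | 2 * r ≤ δ y} := measurableSet_le measurable_const hδ
  have hS : MeasurableSet {p : Amb d × Sph d | 2 * r ≤ δ p.2 ∧ dist p.1 (p.2 : Amb d) < r / 2} :=
    (measurableSet_le measurable_const (hδ.comp measurable_snd)).inter
      (isOpen_lt (f := fun p : Amb d × Sph d => dist p.1 (p.2 : Amb d)) (by fun_prop)
        continuous_const).measurableSet
  have h1 := Measure.prod_apply (μ := (volume : Measure (Amb d))) (ν := sigmaSph d) hS
  rw [Measure.prod_apply_symm hS] at h1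
  refine h1.symm.trans ?_
  rw [← setLIntegral_const, ← lintegral_indicator hA]
  refine lintegral_congr fun y => ?_
  by_cases hy : 2 * r ≤ δ y
  · rw [Set.indicator_of_mem (by simpa using hy), ← volume_ball_zero _ (by positivity),
      ← Measure.addHaar_ball_center volume (y : Amb d)]
    congr 1
    ext u
    simp [hy]
  · rw [Set.indicator_of_notMem (by simpa using hy)]
    simp [hy]

lemma lintegral_layers {δ : Sph d → ℝ} (hδ : Measurable δ) (h0 : ∀ y, 0 ≤ δ y)
    (h2 : ∀ y, δ y ≤ 2) :
    ∫⁻ r in Set.Ioc (0 : ℝ) 1, ENNReal.ofReal (r ^ d) * sigmaSph d {y | 2 * r ≤ δ y} =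
      ENNReal.ofReal ((2 ^ (d + 1) * ((d : ℝ) + 1))⁻¹) *
        ∫⁻ y, ENNReal.ofReal (δ y ^ (d + 1)) ∂sigmaSph d := by
  have h1 : ∀ r : ℝ, ENNReal.ofReal (r ^ d) * sigmaSph d {y | 2 * r ≤ δ y} =
      ∫⁻ y, {p : ℝ × Sph d | 2 * p.1 ≤ δ p.2}.indicator (fun p => ENNReal.ofReal (p.1 ^ d)) (r, y)
        ∂sigmaSph d := by
    intro r
    rw [← setLIntegral_const, ← lintegral_indicator (measurableSet_le measurable_const hδ)]
    rfl
  simp only [h1]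
  rw [lintegral_lintegral_swap, ← lintegral_const_mul' _ _ ENNReal.ofReal_ne_top]
  · refine lintegral_congr fun y => ?_
    have h3 : ∀ r : ℝ, {p : ℝ × Sph d | 2 * p.1 ≤ δ p.2}.indicator
        (fun p => ENNReal.ofReal (p.1 ^ d)) (r, y) =
        (Set.Iic (δ y / 2)).indicator (fun r => ENNReal.ofReal (r ^ d)) r := by
      intro r
      simp only [Set.indicator_apply, Set.mem_ofPred_eq, Set.mem_Iic,
        le_div_iff₀' (two_pos (α := ℝ))]
    simp only [h3]
    rw [lintegral_indicator measurableSet_Iic, Measure.restrict_restrict measurableSet_Iic,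
      Set.Iic_inter_Ioc_of_le (by linarith [h2 y]), ← ofReal_integral_eq_lintegral_ofReal,
      ← intervalIntegral.integral_of_le (by linarith [h0 y]), integral_pow,
      ← ENNReal.ofReal_mul (by positivity)]
    · congr 1
      rw [div_pow]
      field_simp
      simp
    · exact (continuous_pow d).integrableOn_Ioc
    · exact (ae_restrict_iff' measurableSet_Ioc).2 (.of_forall fun r hr => pow_nonneg hr.1.le _)
  · refine Measurable.aemeasurable ?_
    refine Measurable.indicator (by fun_prop) (measurableSet_le (by fun_prop) (by fun_prop))

/-- The energy of a neutral charge is bounded below by the distance to the charged points. -/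
lemma chargeEnergy_ball_ge (d : ℕ) : ∃ c : ℝ, 0 < c ∧ ∀ (n : ℕ) (x : Fin n → Sph d) (w : Fin n → ℝ)
    (δ : Sph d → ℝ), Measurable δ → (∀ y, 0 ≤ δ y) → (∀ y, δ y ≤ 2) →
    (∀ y j, δ y ≤ dist y (x j)) →
    ENNReal.ofReal (c * (∑ j, w j) ^ 2) * ∫⁻ y, ENNReal.ofReal (δ y ^ (d + 1)) ∂sigmaSph d ≤
      chargeEnergy (ballMeasure d) ballKernel x w := by
  have hV0 : 0 < (volume (ball (0 : Amb d) 1)).toReal :=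
    ENNReal.toReal_pos (measure_ball_pos _ _ one_pos).ne' measure_ball_lt_top.ne
  have hK := gapConst_pos (d := d)
  refine ⟨gapConst d * (1 / 2) ^ (d + 1) * (volume (ball (0 : Amb d) 1)).toReal *
    (2 ^ (d + 1) * ((d : ℝ) + 1))⁻¹, by positivity, fun n x w δ hδ h0 h2 hx => ?_⟩
  have hm := ((measurable_charge measurable_ballKernel x w).pow_const 2).ennreal_ofReal
  rw [chargeEnergy, lintegral_ballMeasure hm]
  calc _ = ENNReal.ofReal ((∑ j, w j) ^ 2 * gapConst d * (1 / 2) ^ (d + 1) *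
        (volume (ball (0 : Amb d) 1)).toReal) * (ENNReal.ofReal ((2 ^ (d + 1) * ((d : ℝ) + 1))⁻¹) *
        ∫⁻ y, ENNReal.ofReal (δ y ^ (d + 1)) ∂sigmaSph d) := by
        rw [← mul_assoc, ← ENNReal.ofReal_mul (by positivity)]
        congr 2
        ring
    _ = ∫⁻ r in Set.Ioc (0 : ℝ) 1, ENNReal.ofReal ((∑ j, w j) ^ 2 * gapConst d * (1 / 2) ^ (d + 1) *
        (volume (ball (0 : Amb d) 1)).toReal) *
          (ENNReal.ofReal (r ^ d) * sigmaSph d {y | 2 * r ≤ δ y}) := by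
        rw [lintegral_const_mul' _ _ ENNReal.ofReal_ne_top, lintegral_layers hδ h0 h2]
    _ ≤ ∫⁻ r in Set.Ioc (0 : ℝ) 1, ENNReal.ofReal ((r ^ (d + 1))⁻¹) *
        ∫⁻ u, ENNReal.ofReal ((∑ j, w j * ballKernel (r, u) (x j) -
          (∑ j, w j) * ∫ y, ballKernel (r, u) y ∂sigmaSph d) ^ 2) := by
        refine setLIntegral_mono' measurableSet_Ioc fun r hr => ?_
        have hr0 := hr.1
        refine le_trans ?_ (mul_le_mul_right (lintegral_mono fun u =>
          sigmaSph_gap_le_sq x w hx hr.1 hr.2 u) _)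
        rw [lintegral_const_mul' _ _ ENNReal.ofReal_ne_top, lintegral_sigmaSph_gap hδ hr.1,
          ← mul_assoc, ← mul_assoc, ← mul_assoc, ← ENNReal.ofReal_toReal measure_ball_lt_top.ne,
          ← ENNReal.ofReal_mul (by positivity), ← ENNReal.ofReal_mul (by positivity),
          ← ENNReal.ofReal_mul (by positivity), ← ENNReal.ofReal_mul (by positivity),
          ENNReal.toReal_ofReal (by positivity)]
        refine le_of_eq ?_
        congr 2
        rw [div_pow, div_pow, one_pow]
        field_simp
    _ ≤ _ := lintegral_mono_set Set.Ioc_subset_Ioi_self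

lemma exists_chargeEnergy_cap_eq (d : ℕ) : ∃ k : ℝ, 0 < k ∧ ∀ (n : ℕ) (x : Fin n → Sph d)
    (w : Fin n → ℝ), chargeEnergy (capMeasure d) capKernel x w =
      ENNReal.ofReal k * chargeEnergy (ballMeasure d) ballKernel x w := by
  have hb := ENNReal.toReal_pos (ballConst_ne_zero (d := d)) ballConst_ne_top
  have hc := ENNReal.toReal_pos (capConst_ne_zero (d := d)) capConst_ne_top
  refine ⟨(ballConst d).toReal⁻¹ * (capConst d).toReal, by positivity, fun n x w => ?_⟩
  rw [ENNReal.ofReal_mul (by positivity), ENNReal.ofReal_inv_of_pos hb,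
    ENNReal.ofReal_toReal ballConst_ne_top, ENNReal.ofReal_toReal capConst_ne_top, mul_assoc,
    ← mul_chargeEnergy_cap, ← mul_assoc, ENNReal.inv_mul_cancel ballConst_ne_zero ballConst_ne_top,
    one_mul]

lemma sphDisc_sq_ge (d : ℕ) : ∃ c : ℝ, 0 < c ∧ ∀ (n : ℕ) (x : Fin n → Sph d) (w : Fin n → ℝ)
    (δ : Sph d → ℝ), Measurable δ → (∀ y, 0 ≤ δ y) → (∀ y, δ y ≤ 2) →
    (∀ y j, δ y ≤ dist y (x j)) →
    ENNReal.ofReal c * ∫⁻ y, ENNReal.ofReal (δ y ^ (d + 1)) ∂sigmaSph d ≤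
      ENNReal.ofReal (sphDisc x w ^ 2) := by
  obtain ⟨c, hc, hE⟩ := chargeEnergy_ball_ge d
  obtain ⟨k, hk, hkE⟩ := exists_chargeEnergy_cap_eq d
  refine ⟨min (k * c / 4) ((16 * 2 ^ (d + 1))⁻¹), by positivity, fun n x w δ hδ h0 h2 hx => ?_⟩
  have z₀ : Sph d := ⟨EuclideanSpace.single 0 1, by simp⟩
  rw [ofReal_sphDisc_sq_eq x w z₀]
  by_cases hW : 1 / 2 ≤ |∑ j, w j|
  · have hW2 : 1 / 4 ≤ (∑ j, w j) ^ 2 := by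
      rw [← sq_abs]
      nlinarith
    calc _ ≤ ENNReal.ofReal (k * (c * (∑ j, w j) ^ 2)) *
          ∫⁻ y, ENNReal.ofReal (δ y ^ (d + 1)) ∂sigmaSph d := by
          gcongr
          refine (min_le_left _ _).trans ?_
          have : 0 < k * c := by positivity
          nlinarith
      _ ≤ ENNReal.ofReal k * chargeEnergy (ballMeasure d) ballKernel x w := by
          rw [ENNReal.ofReal_mul hk.le, mul_assoc]
          gcongr
          exact hE n x w δ hδ h0 h2 hx
      _ ≤ _ := by
          rw [← hkE]
          exact le_self_add
  · refine le_trans ?_ le_add_self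
    have hW1 : 1 / 2 ≤ |(∑ j, w j) - 1| := by
      rw [not_le, abs_lt] at hW
      rw [abs_of_nonpos (by linarith)]
      linarith
    calc _ ≤ ENNReal.ofReal ((16 * 2 ^ (d + 1))⁻¹) * ENNReal.ofReal (2 ^ (d + 1)) := by
          gcongr
          · exact min_le_right _ _
          · calc _ ≤ ∫⁻ _, ENNReal.ofReal (2 ^ (d + 1)) ∂sigmaSph d :=
                lintegral_mono fun y => ENNReal.ofReal_le_ofReal (pow_le_pow_left₀ (h0 y) (h2 y) _)
              _ = _ := by simp
      _ = ∫⁻ _ in Set.Icc (-1 : ℝ) 0, ENNReal.ofReal (1 / 16) := by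
          rw [← ENNReal.ofReal_mul (by positivity), setLIntegral_const, Real.volume_Icc,
            ← ENNReal.ofReal_mul (by positivity)]
          congr 1
          field_simp
          norm_num
      _ ≤ ∫⁻ t in Set.Icc (-1 : ℝ) 0,
          ENNReal.ofReal ((((∑ j, w j) - 1) * (sigmaSph d (sphCap z₀ t)).toReal) ^ 2) := by
          refine setLIntegral_mono' measurableSet_Icc fun t ht => ENNReal.ofReal_le_ofReal ?_
          have h3 := half_le_sigmaSph_sphCap z₀ ht.2
          rw [mul_pow, ← sq_abs]
          have h4 : 1 / 4 ≤ |(∑ j, w j) - 1| ^ 2 := by nlinarith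
          have h5 : 1 / 4 ≤ (sigmaSph d (sphCap z₀ t)).toReal ^ 2 := by nlinarith
          nlinarith
      _ ≤ _ := lintegral_mono_set (Set.Icc_subset_Icc_right zero_le_one)

end LowerBound

section PolynomialBounds

open Polynomial in
/-- Functions on the line which are polynomials of degree at most `N`. -/
def IsPolyOfDegree (N : ℕ) (f : ℝ → ℝ) : Prop :=
  ∃ q : ℝ[X], q.natDegree ≤ N ∧ ∀ t, f t = q.eval t

lemma IsPolyOfDegree.comp_mul {N : ℕ} {f : ℝ → ℝ} (hf : IsPolyOfDegree N f) (R : ℝ) :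
    IsPolyOfDegree N fun t => f (R * t) := by
  obtain ⟨q, hq, h⟩ := hf
  refine ⟨q.comp (Polynomial.C R * Polynomial.X), ?_, fun t => by simp [h]⟩
  refine Polynomial.natDegree_comp_le.trans ?_
  calc _ ≤ q.natDegree * 1 := by
        gcongr
        exact (Polynomial.natDegree_C_mul_le _ _).trans Polynomial.natDegree_X_le
    _ ≤ N := by simpa using hq

lemma exists_coeff_bound (N : ℕ) : ∃ K : ℝ, 0 < K ∧ ∀ (q : Polynomial ℝ) (M : ℝ),
    q.natDegree ≤ N → (∀ t ∈ Set.Icc (0 : ℝ) 1, |q.eval t| ≤ M) → ∀ i, |q.coeff i| ≤ K * M := by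
  set v : Fin (N + 1) → ℝ := fun k => (k : ℝ) / (N + 1) with hv
  have hvi : Function.Injective v := fun a b hab => by
    simp only [hv] at hab
    field_simp at hab
    exact Fin.ext (by exact_mod_cast hab)
  set V := Matrix.vandermonde v with hV
  have hdet : IsUnit V.det := isUnit_iff_ne_zero.2 (Matrix.det_vandermonde_ne_zero_iff.2 hvi)
  refine ⟨1 + ∑ i, ∑ k, |V⁻¹ i k|, by positivity, fun q M hq hM i => ?_⟩
  have hM0 : 0 ≤ M := (abs_nonneg _).trans (hM 0 (by simp))
  rcases lt_or_ge N i with hi | hi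
  · rw [Polynomial.coeff_eq_zero_of_natDegree_lt (hq.trans_lt hi), abs_zero]
    positivity
  have h1 : V.mulVec (fun i : Fin (N + 1) => q.coeff i) = fun k => q.eval (v k) := by
    ext k
    rw [Polynomial.eval_eq_sum_range' (Nat.lt_succ_of_le hq), Finset.sum_range]
    simp only [Matrix.mulVec, dotProduct, hV, Matrix.vandermonde_apply]
    exact Finset.sum_congr rfl fun i _ => mul_comm _ _
  have h2 : (fun i : Fin (N + 1) => q.coeff i) = V⁻¹.mulVec fun k => q.eval (v k) := by
    rw [← h1, Matrix.mulVec_mulVec, Matrix.nonsing_inv_mul _ hdet, Matrix.one_mulVec]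
  have h3 := congrFun h2 ⟨i, Nat.lt_succ_of_le hi⟩
  simp only [Matrix.mulVec, dotProduct] at h3
  rw [h3]
  have hvm : ∀ k, |q.eval (v k)| ≤ M := fun k => hM _ ⟨by positivity, by
    simp only [hv]
    rw [div_le_one (by positivity)]
    have : (k : ℕ) ≤ N := Nat.lt_succ_iff.1 k.2
    have : ((k : ℕ) : ℝ) ≤ N := by exact_mod_cast this
    linarith⟩
  calc _ ≤ ∑ k, |V⁻¹ ⟨i, Nat.lt_succ_of_le hi⟩ k| * M := by
        refine (Finset.abs_sum_le_sum_abs _ _).trans (Finset.sum_le_sum fun k _ => ?_)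
        rw [abs_mul]
        gcongr
        exact hvm k
    _ = (∑ k, |V⁻¹ ⟨i, Nat.lt_succ_of_le hi⟩ k|) * M := (Finset.sum_mul _ _ _).symm
    _ ≤ _ := by
        gcongr
        have := Finset.single_le_sum (f := fun i => ∑ k, |V⁻¹ i k|) (s := Finset.univ)
          (fun i _ => Finset.sum_nonneg fun k _ => abs_nonneg _)
          (Finset.mem_univ (⟨i, Nat.lt_succ_of_le hi⟩ : Fin (N + 1)))
        exact this.trans (le_add_of_nonneg_left zero_le_one)

lemma IsPolyOfDegree.exists_bounds (N : ℕ) : ∃ K : ℝ, 1 ≤ K ∧ ∀ (f : ℝ → ℝ) (R M : ℝ),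
    IsPolyOfDegree N f → 0 < R → (∀ t ∈ Set.Icc 0 R, |f t| ≤ M) →
      (∀ t ∈ Set.Icc 0 R, |f t - f 0| ≤ K * (t / R) * M) ∧
      (∀ t ∈ Set.Icc 0 (6 * R), |f t| ≤ K * M) := by
  obtain ⟨K, hK, h⟩ := exists_coeff_bound N
  refine ⟨(N + 1) * K * 6 ^ N + 1, by linarith [show 0 ≤ (N + 1) * K * 6 ^ N by positivity],
    fun f R M hf hR hM => ?_⟩
  obtain ⟨q, hq, hfq⟩ := hf.comp_mul R
  have hM0 : 0 ≤ M := (abs_nonneg _).trans (hM 0 ⟨le_rfl, hR.le⟩)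
  have hfq' : ∀ t, f t = q.eval (t / R) := fun t => by
    have : f (R * (t / R)) = _ := hfq (t / R)
    rwa [mul_div_cancel₀ _ hR.ne'] at this
  have hc := h q M hq fun t ht => by
    rw [← hfq]
    exact hM _ ⟨by nlinarith [ht.1], by nlinarith [ht.2]⟩
  have hsum : ∀ s, q.eval s = q.eval 0 + ∑ i ∈ Finset.range N, q.coeff (i + 1) * s ^ (i + 1) := by
    intro s
    rw [Polynomial.eval_eq_sum_range' (Nat.lt_succ_of_le hq), Finset.sum_range_succ',
      ← Polynomial.coeff_zero_eq_eval_zero]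
    ring
  have hN : (1 : ℝ) ≤ 6 ^ N := one_le_pow₀ (by norm_num)
  constructor
  · intro t ht
    have hs0 : 0 ≤ t / R := div_nonneg ht.1 hR.le
    have hs1 : t / R ≤ 1 := (div_le_one hR).2 ht.2
    rw [hfq', hfq', zero_div, hsum (t / R), add_sub_cancel_left]
    calc _ ≤ ∑ i ∈ Finset.range N, K * M * (t / R) := by
          refine (Finset.abs_sum_le_sum_abs _ _).trans (Finset.sum_le_sum fun i _ => ?_)
          rw [abs_mul, abs_of_nonneg (pow_nonneg hs0 _)]
          exact mul_le_mul (hc _) (pow_le_of_le_one hs0 hs1 (by simp)) (by positivity)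
            (by positivity)
      _ = N * K * 1 * (t / R) * M := by
          rw [Finset.sum_const, Finset.card_range, nsmul_eq_mul]
          ring
      _ ≤ _ := by
          gcongr
          have : N * K * 1 ≤ (N + 1) * K * 6 ^ N := by gcongr; linarith
          linarith
  · intro t ht
    have hs0 : 0 ≤ t / R := div_nonneg ht.1 hR.le
    have hs1 : t / R ≤ 6 := (div_le_iff₀ hR).2 ht.2
    rw [hfq', Polynomial.eval_eq_sum_range' (Nat.lt_succ_of_le hq)]
    calc _ ≤ ∑ i ∈ Finset.range (N + 1), K * M * 6 ^ N := by
          refine (Finset.abs_sum_le_sum_abs _ _).trans (Finset.sum_le_sum fun i hi => ?_)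
          rw [abs_mul, abs_of_nonneg (pow_nonneg hs0 _)]
          refine mul_le_mul (hc _) ?_ (by positivity) (by positivity)
          exact (pow_le_pow_left₀ hs0 hs1 _).trans (pow_le_pow_right₀ (by norm_num)
            (Nat.lt_succ_iff.1 (Finset.mem_range.1 hi)))
      _ = (N + 1) * K * 6 ^ N * M := by
          rw [Finset.sum_const, Finset.card_range, nsmul_eq_mul]
          push_cast
          ring
      _ ≤ _ := by
          gcongr
          linarith

end PolynomialBounds

section GreatCircles

variable {d : ℕ}

/-- Rational parametrization of the great circle through `a` in direction `v`. -/
def greatCircle (a v : Amb d) (t : ℝ) : Amb d :=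
  (1 + t ^ 2)⁻¹ • ((1 - t ^ 2) • a + (2 * t) • v)

lemma greatCircle_zero (a v : Amb d) : greatCircle a v 0 = a := by simp [greatCircle]

/-- Pairs of orthonormal vectors. -/
def IsOrthoPair (a v : Amb d) : Prop := ‖a‖ = 1 ∧ ‖v‖ = 1 ∧ ⟪a, v⟫ = 0

lemma IsOrthoPair.norm_sq_add {a v : Amb d} (h : IsOrthoPair a v) (s t : ℝ) :
    ‖s • a + t • v‖ ^ 2 = s ^ 2 + t ^ 2 := by
  rw [norm_add_sq_real, norm_smul, norm_smul, inner_smul_left, inner_smul_right, h.1, h.2.1, h.2.2]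
  simp

lemma IsOrthoPair.norm_greatCircle {a v : Amb d} (h : IsOrthoPair a v) (t : ℝ) :
    ‖greatCircle a v t‖ = 1 := by
  have h1 : ‖greatCircle a v t‖ ^ 2 = 1 := by
    rw [greatCircle, norm_smul, mul_pow, h.norm_sq_add, norm_inv,
      Real.norm_of_nonneg (by positivity)]
    field_simp
    ring
  nlinarith [norm_nonneg (greatCircle a v t)]

lemma IsOrthoPair.norm_greatCircle_sub_sq {a v : Amb d} (h : IsOrthoPair a v) (t : ℝ) :
    ‖greatCircle a v t - a‖ ^ 2 = 4 * t ^ 2 / (1 + t ^ 2) := by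
  have h1 : greatCircle a v t - a = (1 + t ^ 2)⁻¹ • ((-2 * t ^ 2) • a + (2 * t) • v) := by
    rw [greatCircle, ← sub_eq_zero]
    have h0 : (1 + t ^ 2) ≠ 0 := by positivity
    match_scalars <;> field_simp <;> ring
  rw [h1, norm_smul, mul_pow, h.norm_sq_add, norm_inv, Real.norm_of_nonneg (by positivity)]
  field_simp
  ring

lemma IsOrthoPair.norm_greatCircle_sub_le {a v : Amb d} (h : IsOrthoPair a v) {t : ℝ}
    (ht : 0 ≤ t) : ‖greatCircle a v t - a‖ ≤ 2 * t := by
  have h1 := h.norm_greatCircle_sub_sq t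
  rw [eq_div_iff (by positivity)] at h1
  refine abs_le_of_sq_le_sq' ?_ (by positivity) |>.2
  nlinarith [sq_nonneg t, sq_nonneg ‖greatCircle a v t - a‖,
    mul_nonneg (sq_nonneg t) (sq_nonneg ‖greatCircle a v t - a‖)]

lemma exists_greatCircle_eq {a b : Amb d} (ha : ‖a‖ = 1) (hb : ‖b‖ = 1) (hab : a ≠ b)
    (hd : ‖b - a‖ ≤ 1) : ∃ (v : Amb d) (t : ℝ), IsOrthoPair a v ∧ 0 ≤ t ∧ t ≤ ‖b - a‖ ∧
      greatCircle a v t = b := by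
  set c := ⟪a, b⟫ with hc
  have hc1 : ‖b - a‖ ^ 2 = 2 - 2 * c := by
    rw [norm_sub_sq_real, ha, hb, real_inner_comm, ← hc]
    ring
  have hpos : 0 < ‖b - a‖ := norm_pos_iff.2 (sub_ne_zero.2 hab.symm)
  have hclt : c < 1 := by nlinarith
  have hcge : 1 / 2 ≤ c := by nlinarith
  have hn : ‖b - c • a‖ ^ 2 = 1 - c ^ 2 := by
    rw [norm_sub_sq_real, norm_smul, inner_smul_right, real_inner_comm, ← hc, ha, hb,
      Real.norm_of_nonneg (by linarith)]
    ring
  have hn0 : 0 < ‖b - c • a‖ := by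
    refine (norm_nonneg _).lt_of_ne' fun h0 => ?_
    rw [h0] at hn
    nlinarith
  set N := ‖b - c • a‖ with hN
  have horth : IsOrthoPair a (N⁻¹ • (b - c • a)) := by
    refine ⟨ha, by rw [norm_smul, norm_inv, norm_norm, inv_mul_cancel₀ hn0.ne'], ?_⟩
    rw [inner_smul_right, inner_sub_right, inner_smul_right, real_inner_self_eq_norm_sq, ha, ← hc]
    simp
  have hpt : greatCircle a (N⁻¹ • (b - c • a)) (N / (1 + c)) = b := by
    have h1 : 1 + (N / (1 + c)) ^ 2 = 2 / (1 + c) := by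
      rw [div_pow, hn]
      field_simp
      ring
    rw [greatCircle, h1, ← sub_eq_zero]
    have h2 : 1 - (N / (1 + c)) ^ 2 = 2 * c / (1 + c) := by
      rw [div_pow, hn]
      field_simp
      ring
    rw [h2]
    have : 1 + c ≠ 0 := by positivity
    have : N ≠ 0 := hn0.ne'
    match_scalars <;> field_simp <;> ring
  refine ⟨_, N / (1 + c), horth, by positivity, ?_, hpt⟩
  refine abs_le_of_sq_le_sq' ?_ hpos.le |>.2
  rw [div_pow, hn, hc1, div_le_iff₀ (by positivity)]
  nlinarith

/-- Continuous functions which, on every great circle, are polynomials of degree at most `2 * m`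
in the rational parameter, after multiplication by the `m`-th power of the denominator. -/
def circlePoly (d m : ℕ) : Submodule ℝ (Amb d → ℝ) where
  carrier := {p | Continuous p ∧ ∀ a v, IsOrthoPair a v →
    IsPolyOfDegree (2 * m) fun t => p (greatCircle a v t) * (1 + t ^ 2) ^ m}
  zero_mem' := ⟨continuous_zero, fun _ _ _ => ⟨0, by simp, fun t => by simp⟩⟩
  add_mem' := by
    rintro p₁ p₂ ⟨hc₁, h₁⟩ ⟨hc₂, h₂⟩
    refine ⟨hc₁.add hc₂, fun a v hav => ?_⟩
    obtain ⟨q₁, hq₁, he₁⟩ := h₁ a v hav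
    obtain ⟨q₂, hq₂, he₂⟩ := h₂ a v hav
    refine ⟨q₁ + q₂, (Polynomial.natDegree_add_le _ _).trans (max_le hq₁ hq₂), fun t => ?_⟩
    rw [Polynomial.eval_add, ← he₁, ← he₂]
    exact add_mul _ _ _
  smul_mem' := by
    rintro s p ⟨hc, h⟩
    refine ⟨hc.const_smul s, fun a v hav => ?_⟩
    obtain ⟨q, hq, he⟩ := h a v hav
    refine ⟨s • q, (Polynomial.natDegree_smul_le _ _).trans hq, fun t => ?_⟩
    rw [Polynomial.eval_smul, ← he]
    exact mul_assoc _ _ _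

lemma affine_pow_mem_circlePoly (m : ℕ) (α : ℝ) (u : Amb d) :
    (fun x => (α + ⟪u, x⟫) ^ m) ∈ circlePoly d m := by
  refine ⟨by fun_prop, fun a v hav => ?_⟩
  refine ⟨(Polynomial.C (α - ⟪u, a⟫) * Polynomial.X ^ 2 + Polynomial.C (2 * ⟪u, v⟫) * Polynomial.X +
    Polynomial.C (α + ⟪u, a⟫)) ^ m, ?_, fun t => ?_⟩
  · refine Polynomial.natDegree_pow_le.trans ?_
    rw [mul_comm]
    gcongr
    exact Polynomial.natDegree_quadratic_le
  · beta_reduce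
    rw [← mul_pow, greatCircle, inner_smul_right, inner_add_right, inner_smul_right,
      inner_smul_right]
    simp only [Polynomial.eval_pow, Polynomial.eval_add, Polynomial.eval_mul, Polynomial.eval_C,
      Polynomial.eval_X]
    congr 1
    field_simp
    ring

lemma one_mem_circlePoly (m : ℕ) : (fun _ => (1 : ℝ)) ∈ circlePoly d m := by
  simpa using affine_pow_mem_circlePoly (d := d) m 1 0

lemma le_two_pow_of_le_one {t : ℝ} (h0 : 0 ≤ t) (h1 : t ≤ 1) (m : ℕ) :
    1 ≤ (1 + t ^ 2) ^ m ∧ (1 + t ^ 2) ^ m ≤ 2 ^ m :=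
  ⟨one_le_pow₀ (by nlinarith), pow_le_pow_left₀ (by positivity) (by nlinarith) m⟩

/-- Sufficiently dense subsets are norming for `circlePoly`, locally and at every small scale. -/
lemma exists_norming_density (d m : ℕ) : ∃ η K : ℝ, 0 < η ∧ η ≤ 1 ∧ 0 < K ∧
    ∀ p ∈ circlePoly d m, ∀ (y : Sph d) (R M : ℝ) (X : Set (Sph d)), 0 < R → R ≤ 1 / 3 →
    (∀ x ∈ closedBall y R, ∃ z ∈ X, dist x z ≤ η * R) →
    (∀ z ∈ X, z ∈ closedBall y (2 * R) → |p (z : Amb d)| ≤ M) →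
    ∀ x ∈ closedBall y R, |p (x : Amb d)| ≤ K * M := by
  obtain ⟨C, hC1, hC⟩ := IsPolyOfDegree.exists_bounds (2 * m)
  have hD : (1 : ℝ) ≤ C * 2 ^ m * (C * 2 ^ m) :=
    one_le_mul_of_one_le_of_one_le (one_le_mul_of_one_le_of_one_le hC1 (one_le_pow₀ one_le_two))
      (one_le_mul_of_one_le_of_one_le hC1 (one_le_pow₀ one_le_two))
  set D : ℝ := C * 2 ^ m * (C * 2 ^ m) with hDdef
  refine ⟨(2 * D)⁻¹, 2 * 2 ^ m, by positivity, inv_le_one_of_one_le₀ (by linarith),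
    by positivity, ?_⟩
  rintro p ⟨hpc, hp⟩ y R M' X hR hR3 hX hM'
  have hcont : Continuous fun x : Sph d => |p (x : Amb d)| := by fun_prop
  obtain ⟨x', hx', hmax⟩ := (isCompact_closedBall y R).exists_isMaxOn
    ⟨y, mem_closedBall_self hR.le⟩ hcont.continuousOn
  set M := |p (x' : Amb d)| with hM
  have hmax' : ∀ x ∈ closedBall y R, |p (x : Amb d)| ≤ M := fun x hx => hmax hx
  have hM0 : 0 ≤ M := abs_nonneg _
  suffices h : M ≤ 2 * 2 ^ m * M' from fun x hx => (hmax' x hx).trans h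
  have hA : ∀ b ∈ closedBall y (3 * R), |p (b : Amb d)| ≤ C * 2 ^ m * M := by
    intro b hb
    rw [mem_closedBall, Subtype.dist_eq, dist_eq_norm] at hb
    rcases eq_or_ne (y : Amb d) b with hyb | hyb
    · rw [← hyb]
      have h1 := hmax' y (mem_closedBall_self hR.le)
      have h2 : 1 ≤ C * 2 ^ m := one_le_mul_of_one_le_of_one_le hC1 (one_le_pow₀ one_le_two)
      nlinarith
    obtain ⟨v, t, hav, ht0, ht, hbt⟩ := exists_greatCircle_eq (a := (y : Amb d)) (b := b) (by simp)
      (by simp) hyb (by linarith)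
    have h1 := (hC _ (R / 2) (2 ^ m * M) (hp y v hav) (by positivity) fun s hs => by
      have h2 := hmax' ⟨greatCircle y v s, by simpa using hav.norm_greatCircle s⟩ (by
        rw [mem_closedBall, Subtype.dist_eq, dist_eq_norm]
        exact (hav.norm_greatCircle_sub_le hs.1).trans (by linarith [hs.2]))
      obtain ⟨h3, h4⟩ := le_two_pow_of_le_one hs.1 (by linarith [hs.2]) m
      rw [abs_mul, abs_of_nonneg (by linarith : 0 ≤ (1 + s ^ 2) ^ m), mul_comm]
      exact mul_le_mul h4 h2 (abs_nonneg _) (by positivity)).2 t ⟨ht0, by linarith⟩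
    obtain ⟨h3, h4⟩ := le_two_pow_of_le_one ht0 (by linarith) m
    rw [hbt, abs_mul, abs_of_nonneg (by linarith : 0 ≤ (1 + t ^ 2) ^ m)] at h1
    nlinarith [abs_nonneg (p (b : Amb d))]
  obtain ⟨z, hzX, hz⟩ := hX x' hx'
  have hη : (2 * D)⁻¹ * R ≤ R := mul_le_of_le_one_left hR.le (inv_le_one_of_one_le₀ (by linarith))
  have hzM := hM' z hzX (by
    rw [mem_closedBall] at hx' ⊢
    linarith [dist_triangle_left z y x'])
  have hM'0 : 0 ≤ M' := (abs_nonneg _).trans hzM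
  have h2m : (1 : ℝ) ≤ 2 ^ m := one_le_pow₀ one_le_two
  rw [Subtype.dist_eq, dist_comm, dist_eq_norm] at hz
  rcases eq_or_ne (x' : Amb d) z with hxz | hxz
  · rw [hM, hxz]
    nlinarith
  obtain ⟨v, t, hav, ht0, ht, hbt⟩ := exists_greatCircle_eq (a := (x' : Amb d)) (b := z) (by simp)
      (by simp) hxz (by linarith)
  have h1 := (hC _ R (2 ^ m * (C * 2 ^ m * M)) (hp x' v hav) hR fun s hs => by
    have h2 := hA ⟨greatCircle x' v s, by simpa using hav.norm_greatCircle s⟩ (by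
      have h5 := hav.norm_greatCircle_sub_le hs.1
      rw [mem_closedBall, Subtype.dist_eq] at hx' ⊢
      rw [← dist_eq_norm] at h5
      linarith [dist_triangle (greatCircle (x' : Amb d) v s) x' y, hs.2])
    obtain ⟨h3, h4⟩ := le_two_pow_of_le_one hs.1 (by linarith [hs.2]) m
    rw [abs_mul, abs_of_nonneg (by linarith : 0 ≤ (1 + s ^ 2) ^ m), mul_comm]
    exact mul_le_mul h4 h2 (abs_nonneg _) (by positivity)).1 t ⟨ht0, by linarith⟩
  obtain ⟨h3, h4⟩ := le_two_pow_of_le_one ht0 (by linarith) m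
  simp only [hbt, greatCircle_zero] at h1
  have h5 : C * (t / R) * (2 ^ m * (C * 2 ^ m * M)) ≤ M / 2 := by
    have h6 : t / R ≤ (2 * D)⁻¹ := (div_le_iff₀ hR).2 (by linarith)
    calc _ = (t / R) * (D * M) := by rw [hDdef]; ring
      _ ≤ (2 * D)⁻¹ * (D * M) := by gcongr
      _ = M / 2 := by field_simp
  have h7 : |p (z : Amb d) * (1 + t ^ 2) ^ m| ≤ 2 ^ m * M' := by
    rw [abs_mul, abs_of_nonneg (by linarith : 0 ≤ (1 + t ^ 2) ^ m), mul_comm]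
    exact mul_le_mul h4 hzM (abs_nonneg _) (by positivity)
  have h8 := abs_sub_abs_le_abs_sub (p (x' : Amb d)) (p (z : Amb d) * (1 + t ^ 2) ^ m)
  rw [abs_sub_comm] at h8
  norm_num at h1
  linarith

end GreatCircles

section LocalWeights

variable {d n : ℕ}

open scoped ENNReal

lemma exists_weights_of_abs_le {E : Type*} [AddCommGroup E] [Module ℝ E]
    (ev : E →ₗ[ℝ] (Fin n → ℝ)) (Λ : E →ₗ[ℝ] ℝ) {B : ℝ} (hB : 0 ≤ B)
    (h : ∀ p, |Λ p| ≤ B * ‖ev p‖) :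
    ∃ a : Fin n → ℝ, ∑ j, |a j| ≤ B ∧ ∀ p, Λ p = ∑ j, a j * ev p j := by
  obtain ⟨s, hs⟩ := ev.rangeRestrict.exists_rightInverse_of_surjective ev.range_rangeRestrict
  have hs' : ∀ v, ev (s v) = v := fun v => by
    have := congrArg Subtype.val (LinearMap.congr_fun hs v)
    simpa using this
  let g : LinearMap.range ev →L[ℝ] ℝ := (Λ ∘ₗ s).mkContinuous B fun v => by
    have := h (s v)
    rw [hs'] at this
    simpa using this
  obtain ⟨G, hG, hGn⟩ := exists_extension_norm_eq _ g
  have hgB : ‖G‖ ≤ B := hGn.trans_le (LinearMap.mkContinuous_norm_le _ hB _)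
  have hGs : ∀ v : Fin n → ℝ, G v = ∑ j, G (Pi.single j 1) * v j := fun v => by
    conv_lhs => rw [pi_eq_sum_univ' v, map_sum]
    refine Finset.sum_congr rfl fun j _ => ?_
    rw [map_smul, smul_eq_mul, mul_comm]
  refine ⟨fun j => G (Pi.single j 1), ?_, fun p => ?_⟩
  · have h1 : ∑ j, |G (Pi.single j 1)| = G fun j => SignType.sign (G (Pi.single j 1)) := by
      rw [hGs]
      exact Finset.sum_congr rfl fun j _ => by rw [self_mul_sign]
    rw [h1]
    refine (le_abs_self _).trans ((G.le_opNorm _).trans ?_)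
    refine (mul_le_of_le_one_right (norm_nonneg _) ?_).trans hgB
    refine (pi_norm_le_iff_of_nonneg zero_le_one).2 fun j => ?_
    rcases lt_trichotomy (G (Pi.single j 1)) 0 with h | h | h <;> simp [h]
  · rw [← hGs, show ev p = ((ev.rangeRestrict p : LinearMap.range ev) : Fin n → ℝ) from rfl, hG]
    have h2 := h (p - s (ev.rangeRestrict p))
    have h4 : ev (s (ev.rangeRestrict p)) = ev p := hs' _
    rw [map_sub ev, h4, sub_self, norm_zero, mul_zero] at h2
    have h3 := abs_nonpos_iff.1 h2
    rw [map_sub, sub_eq_zero] at h3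
    exact h3

lemma integrable_sigmaSph_of_continuous {p : Amb d → ℝ} (hp : Continuous p) :
    Integrable (fun z : Sph d => p z) (sigmaSph d) :=
  (hp.comp continuous_subtype_val).integrable_of_hasCompactSupport
    (HasCompactSupport.of_compactSpace _)

lemma exists_local_weights (d m : ℕ) : ∃ η K : ℝ, 0 < η ∧ η ≤ 1 ∧ 0 < K ∧
    ∀ (n : ℕ) (x : Fin n → Sph d) (y : Sph d) (ρ : ℝ) (Q : Set (Sph d)), 0 < ρ → ρ ≤ 1 →
      MeasurableSet Q → Q ⊆ closedBall y (ρ / 8) →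
      (∀ z ∈ closedBall y (ρ / 8), ∃ j, dist z (x j) ≤ η * ρ) →
      ∃ a : Fin n → ℝ, (∀ j, a j ≠ 0 → dist (x j) y ≤ ρ / 4) ∧
        ∑ j, |a j| ≤ K * (sigmaSph d).real Q ∧
        ∀ p ∈ circlePoly d m, ∑ j, a j * p (x j) = ∫ z in Q, p z ∂sigmaSph d := by
  obtain ⟨η, K, hη, hη1, hK, H⟩ := exists_norming_density d m
  refine ⟨η / 8, K, by positivity, by linarith, hK, ?_⟩
  intro n x y ρ Q hρ hρ1 hQ hQy hdata
  let χ : Fin n → ℝ := fun j => if dist (x j) y ≤ ρ / 4 then 1 else 0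
  let ev : circlePoly d m →ₗ[ℝ] (Fin n → ℝ) :=
    { toFun := fun p j => χ j * (p : Amb d → ℝ) (x j)
      map_add' := fun p q => by ext j; simp [mul_add]
      map_smul' := fun c p => by ext j; simp; ring }
  let Λ : circlePoly d m →ₗ[ℝ] ℝ :=
    { toFun := fun p => ∫ z in Q, (p : Amb d → ℝ) z ∂sigmaSph d
      map_add' := fun p q => by
        exact integral_add (integrable_sigmaSph_of_continuous p.2.1).integrableOn
          (integrable_sigmaSph_of_continuous q.2.1).integrableOn
      map_smul' := fun c p => by exact integral_const_mul c _ }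
  obtain ⟨a, ha, ha'⟩ := exists_weights_of_abs_le ev Λ (B := K * (sigmaSph d).real Q)
    (by positivity) fun p => by
      have h1 : ∀ z ∈ Q, ‖(p : Amb d → ℝ) z‖ ≤ K * ‖ev p‖ := fun z hz =>
        H p p.2 y (ρ / 8) ‖ev p‖ (Set.range x) (by positivity) (by linarith)
          (fun w hw => by
            obtain ⟨j, hj⟩ := hdata w hw
            exact ⟨x j, ⟨j, rfl⟩, hj.trans (by linarith)⟩)
          (by
            rintro _ ⟨j, rfl⟩ hj
            have h2 := norm_le_pi_norm (ev p) j
            have h3 : dist (x j) y ≤ ρ / 4 := by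
              have := mem_closedBall.1 hj
              linarith
            have h4 : ev p j = (p : Amb d → ℝ) (x j) := by simp [ev, χ, h3]
            rw [h4] at h2
            exact h2) z (hQy hz)
      have h2 := norm_setIntegral_le_of_norm_le_const (measure_lt_top (sigmaSph d) Q) h1
      calc |Λ p| ≤ _ := h2
        _ = _ := by ring
  refine ⟨fun j => a j * χ j, fun j hj => ?_, ?_, fun p hp => ?_⟩
  · by_contra hc
    simp [χ, hc] at hj
  · refine le_trans (Finset.sum_le_sum fun j _ => ?_) ha
    rw [abs_mul]
    refine mul_le_of_le_one_right (abs_nonneg _) ?_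
    simp only [χ]
    split_ifs <;> simp
  · have := ha' ⟨p, hp⟩
    simp only [mul_assoc]
    exact this.symm

end LocalWeights

section Cells

variable {d n : ℕ}

open scoped ENNReal

lemma abs_profile_sub_le {m : ℕ} (hm : m ≠ 0) (s Δ : ℝ) :
    |profile m (s + Δ) - (if s ≤ 1 then (1 - s - Δ) ^ m else 0)| ≤ |Δ| ^ m := by
  split_ifs with hs
  · rcases le_total (s + Δ) 1 with h | h
    · rw [profile_of_le_one _ h, ← sub_sub, sub_self, abs_zero]
      positivity
    · rw [profile_eq_zero hm h, zero_sub, abs_neg, abs_pow]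
      refine pow_le_pow_left₀ (abs_nonneg _) ?_ _
      rw [abs_of_nonpos (by linarith)]
      linarith [le_abs_self Δ]
  · rw [sub_zero, abs_of_nonneg (profile_nonneg _ _), profile]
    refine pow_le_pow_left₀ (le_max_left _ _) (max_le (abs_nonneg _) ?_) _
    linarith [neg_abs_le Δ]

/-- A cell `Q` near `y` at scale `ρ` whose uniform measure is replaced by point masses `a` which
are exact on polynomials. -/
structure IsCell (x : Fin n → Sph d) (K : ℝ) (y : Sph d) (ρ : ℝ) (Q : Set (Sph d))
    (a : Fin n → ℝ) : Prop where
  pos : 0 < ρ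
  measurableSet : MeasurableSet Q
  subset : Q ⊆ closedBall y (ρ / 8)
  support : ∀ j, a j ≠ 0 → dist (x j) y ≤ ρ / 4
  sum_abs_le : ∑ j, |a j| ≤ K * (sigmaSph d).real Q
  exact : ∀ p ∈ circlePoly d (d + 1), ∑ j, a j * p (x j) = ∫ z in Q, p z ∂sigmaSph d

/-- The potential of the neutral charge attached to a cell. -/
def cellCharge (x : Fin n → Sph d) (Q : Set (Sph d)) (a : Fin n → ℝ) (ω : ℝ × Amb d) : ℝ :=
  ∑ j, a j * ballKernel ω (x j) - ∫ z in Q, ballKernel ω z ∂sigmaSph d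

/-- The potential of the total variation of the charge attached to a cell. -/
def cellMass (x : Fin n → Sph d) (Q : Set (Sph d)) (a : Fin n → ℝ) (ω : ℝ × Amb d) : ℝ :=
  ∑ j, |a j| * ballKernel ω (x j) + ∫ z in Q, ballKernel ω z ∂sigmaSph d

lemma integrable_ballKernel (ω : ℝ × Amb d) : Integrable (ballKernel ω) (sigmaSph d) :=
  Integrable.of_bound (continuous_ballKernel ω).aestronglyMeasurable 1
    (.of_forall (abs_ballKernel_le_one ω))

lemma abs_cellCharge_le_cellMass (x : Fin n → Sph d) (Q : Set (Sph d)) (a : Fin n → ℝ)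
    (ω : ℝ × Amb d) : |cellCharge x Q a ω| ≤ cellMass x Q a ω := by
  refine (abs_sub _ _).trans (add_le_add ?_ ?_)
  · refine (Finset.abs_sum_le_sum_abs _ _).trans (Finset.sum_le_sum fun j _ => ?_)
    rw [abs_mul, abs_of_nonneg (ballKernel_nonneg _ _)]
  · rw [abs_of_nonneg (integral_nonneg fun z => ballKernel_nonneg _ _)]

lemma abs_cellSum_le {x : Fin n → Sph d} {K : ℝ} {y : Sph d} {ρ : ℝ} {Q : Set (Sph d)}
    {a : Fin n → ℝ} (h : IsCell x K y ρ Q a) {f : Sph d → ℝ} {B : ℝ} (hB : 0 ≤ B)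
    (hf : ∀ z, dist z y ≤ ρ / 4 → |f z| ≤ B) :
    |∑ j, a j * f (x j) - ∫ z in Q, f z ∂sigmaSph d| ≤ (K + 1) * (sigmaSph d).real Q * B := by
  have h1 : |∑ j, a j * f (x j)| ≤ K * (sigmaSph d).real Q * B := by
    refine (Finset.abs_sum_le_sum_abs _ _).trans ?_
    refine le_trans (Finset.sum_le_sum (g := fun j => |a j| * B) fun j _ => ?_) ?_
    · rw [abs_mul]
      by_cases hj : a j = 0
      · simp [hj]
      · exact mul_le_mul_of_nonneg_left (hf _ (h.support j hj)) (abs_nonneg _)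
    · rw [← Finset.sum_mul]
      exact mul_le_mul_of_nonneg_right h.sum_abs_le hB
  have h2 : ‖∫ z in Q, f z ∂sigmaSph d‖ ≤ B * (sigmaSph d).real Q :=
    norm_setIntegral_le_of_norm_le_const (measure_lt_top (sigmaSph d) Q) fun z hz =>
      hf z ((mem_closedBall.1 (h.subset hz)).trans (by linarith [h.pos]))
  calc _ ≤ _ := abs_sub _ _
    _ ≤ _ := add_le_add h1 h2
    _ = _ := by ring

lemma abs_cellCharge_le {x : Fin n → Sph d} {K : ℝ} {y : Sph d} {ρ : ℝ} {Q : Set (Sph d)}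
    {a : Fin n → ℝ} (h : IsCell x K y ρ Q a) (ω : ℝ × Amb d) :
    |cellCharge x Q a ω| ≤ (K + 1) * (sigmaSph d).real Q := by
  have := abs_cellSum_le h zero_le_one (f := ballKernel ω) fun z _ => abs_ballKernel_le_one ω z
  rwa [mul_one] at this

lemma cellCharge_eq_zero {x : Fin n → Sph d} {K : ℝ} {y : Sph d} {ρ : ℝ} {Q : Set (Sph d)}
    {a : Fin n → ℝ} (h : IsCell x K y ρ Q a) {r : ℝ} (hr : 0 < r) {u : Amb d}
    (hu : r + ρ / 4 ≤ dist u y) : cellCharge x Q a (r, u) = 0 := by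
  have := abs_cellSum_le h le_rfl (f := ballKernel (r, u)) fun z hz => by
    rw [ballKernel_eq_zero hr, abs_zero]
    have h1 : dist u y ≤ dist u z + dist (z : Amb d) y := dist_triangle _ _ _
    have h2 : dist (z : Amb d) y ≤ ρ / 4 := hz
    linarith
  rw [mul_zero] at this
  exact abs_nonpos_iff.1 this

lemma abs_cellCharge_le_pow {x : Fin n → Sph d} {K : ℝ} {y : Sph d} {ρ : ℝ} {Q : Set (Sph d)}
    {a : Fin n → ℝ} (h : IsCell x K y ρ Q a) {r : ℝ} (hr : ρ ≤ r) (u : Amb d) :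
    |cellCharge x Q a (r, u)| ≤ (K + 1) * (sigmaSph d).real Q * (ρ / r) ^ (d + 1) := by
  have hρ := h.pos
  have hr0 : 0 < r := hρ.trans_le hr
  by_cases hu : r + ρ / 4 ≤ dist u y
  · have hK : 0 ≤ K * (sigmaSph d).real Q :=
      (Finset.sum_nonneg fun j _ => abs_nonneg _).trans h.sum_abs_le
    rw [cellCharge_eq_zero h hr0 hu, abs_zero]
    have := measureReal_nonneg (μ := sigmaSph d) (s := Q)
    have : 0 ≤ (K + 1) * (sigmaSph d).real Q := by linarith
    positivity
  push Not at hu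
  set s : ℝ := ‖u - y‖ ^ 2 / r ^ 2 with hs
  let Δ : Amb d → ℝ := fun z => (r ^ 2)⁻¹ * (-2 * ⟪u, z - y⟫)
  let q : Amb d → ℝ := if s ≤ 1 then fun z => (1 - s - Δ z) ^ (d + 1) else 0
  have hq : q ∈ circlePoly d (d + 1) := by
    simp only [q]
    split_ifs
    · have := affine_pow_mem_circlePoly (d := d) (d + 1) (1 - s - 2 * (r ^ 2)⁻¹ * ⟪u, (y : Amb d)⟫)
        ((2 * (r ^ 2)⁻¹) • u)
      convert this using 3 with z
      simp only [Δ, inner_sub_right, real_inner_smul_left]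
      ring
    · exact Submodule.zero_mem _
  have hker : ∀ z : Sph d, ballKernel (r, u) z = profile (d + 1) (s + Δ z) := fun z => by
    unfold ballKernel bump
    congr 1
    have hz : ‖(z : Amb d)‖ = 1 := by simp
    have hy : ‖(y : Amb d)‖ = 1 := by simp
    rw [norm_smul, mul_pow, norm_inv, Real.norm_of_nonneg hr0.le, hs, norm_sub_sq_real,
      norm_sub_sq_real, hz, hy]
    simp only [Δ, inner_sub_right]
    field_simp
    ring
  have hΔ : ∀ z : Sph d, dist z y ≤ ρ / 4 → |Δ z| ≤ ρ / r := fun z hz => by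
    have h1 : ‖(z : Amb d) - y‖ ≤ ρ / 4 := by
      rw [← dist_eq_norm]; exact hz
    have hu2 : ‖u - y‖ ≤ r + ρ / 4 := by rw [← dist_eq_norm]; exact hu.le
    have hz1 : ‖(z : Amb d)‖ = 1 := by simp
    have hy : ‖(y : Amb d)‖ = 1 := by simp
    have h3 : ⟪u, (z : Amb d) - (y : Amb d)⟫ = ⟪u - (y : Amb d), (z : Amb d) - (y : Amb d)⟫ -
        ‖(z : Amb d) - y‖ ^ 2 / 2 := by
      rw [norm_sub_sq_real, inner_sub_left, inner_sub_right (y : Amb d), hz1, hy,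
        real_inner_self_eq_norm_sq, hy, real_inner_comm (z : Amb d) (y : Amb d)]
      ring
    have h4 := abs_real_inner_le_norm (u - (y : Amb d)) ((z : Amb d) - (y : Amb d))
    have h5 : ‖u - (y : Amb d)‖ * ‖(z : Amb d) - y‖ ≤ (r + ρ / 4) * (ρ / 4) := by gcongr
    have h6 : ‖(z : Amb d) - y‖ ^ 2 ≤ (ρ / 4) ^ 2 := by gcongr
    have h7 : |⟪u, (z : Amb d) - (y : Amb d)⟫| ≤ r * ρ / 2 := by
      rw [h3]
      refine (abs_sub _ _).trans ?_
      rw [abs_of_nonneg (a := ‖(z : Amb d) - y‖ ^ 2 / 2) (by positivity)]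
      nlinarith
    simp only [Δ]
    rw [abs_mul, abs_mul, abs_neg, abs_two, abs_of_nonneg (by positivity)]
    calc _ ≤ (r ^ 2)⁻¹ * (2 * (r * ρ / 2)) := by gcongr
      _ = ρ / r := by field_simp
  have key := abs_cellSum_le h (f := fun z => ballKernel (r, u) z - q z)
    (B := (ρ / r) ^ (d + 1)) (by positivity) fun z hz => by
      have h1 := abs_profile_sub_le (Nat.succ_ne_zero d) s (Δ z)
      have h2 : q z = if s ≤ 1 then (1 - s - Δ z) ^ (d + 1) else 0 := by
        simp only [q]; split_ifs <;> rfl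
      rw [hker, h2]
      exact h1.trans (pow_le_pow_left₀ (abs_nonneg _) (hΔ z hz) _)
  convert key using 2
  rw [integral_sub (integrable_ballKernel _).integrableOn
    (integrable_sigmaSph_of_continuous hq.1).integrableOn, ← h.exact q hq]
  simp only [cellCharge, mul_sub, Finset.sum_sub_distrib]
  ring

end Cells

section CellMajorants

variable {d n : ℕ}

open scoped ENNReal

lemma lintegral_ballKernel_le {r : ℝ} (hr : 0 < r) (z : Sph d) :
    ∫⁻ u, ENNReal.ofReal (ballKernel (r, u) z) ≤
      ENNReal.ofReal (r ^ (d + 1)) * volume (ball (0 : Amb d) 1) := by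
  have h := lintegral_comp_inv_smul_sub (f := fun v : Amb d => ENNReal.ofReal (bump v))
    (continuous_bump.measurable.ennreal_ofReal) hr z
  simp only [ballKernel]
  rw [h, ← lintegral_indicator_one measurableSet_ball]
  gcongr with v
  by_cases hv : v ∈ ball (0 : Amb d) 1
  · rw [Set.indicator_of_mem hv]
    simpa using bump_le_one v
  · rw [bump_eq_zero (by simpa using hv)]
    simp

lemma measurable_ballKernel_right (r : ℝ) :
    Measurable (Function.uncurry fun (u : Amb d) (z : Sph d) => ballKernel (r, u) z) :=
  (measurable_ballKernel (d := d)).comp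
    (f := fun p : Amb d × Sph d => (((r, p.1) : ℝ × Amb d), p.2))
    ((measurable_const.prodMk measurable_fst).prodMk measurable_snd)

lemma measurable_cellMass (x : Fin n → Sph d) (Q : Set (Sph d)) (a : Fin n → ℝ) (r : ℝ) :
    Measurable fun u => cellMass x Q a (r, u) := by
  have h := measurable_ballKernel_right (d := d) r
  refine Measurable.add (Finset.measurable_sum _ fun j _ => ?_) ?_
  · exact (h.comp (measurable_id.prodMk measurable_const)).const_mul _
  · exact (h.stronglyMeasurable.integral_prod_right (ν := (sigmaSph d).restrict Q)).measurable

lemma lintegral_cellMass_le {x : Fin n → Sph d} {K : ℝ} {y : Sph d} {ρ : ℝ} {Q : Set (Sph d)}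
    {a : Fin n → ℝ} (h : IsCell x K y ρ Q a) {r : ℝ} (hr : 0 < r) :
    ∫⁻ u, ENNReal.ofReal (cellMass x Q a (r, u)) ≤
      ENNReal.ofReal ((K + 1) * (sigmaSph d).real Q) *
        (ENNReal.ofReal (r ^ (d + 1)) * volume (ball (0 : Amb d) 1)) := by
  set V := ENNReal.ofReal (r ^ (d + 1)) * volume (ball (0 : Amb d) 1)
  have hmeas := measurable_ballKernel_right (d := d) r
  have hK : 0 ≤ K * (sigmaSph d).real Q :=
    (Finset.sum_nonneg fun j _ => abs_nonneg _).trans h.sum_abs_le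
  have e : ∀ u, ENNReal.ofReal (cellMass x Q a (r, u)) =
      ∑ j, ENNReal.ofReal |a j| * ENNReal.ofReal (ballKernel (r, u) (x j)) +
        ∫⁻ z in Q, ENNReal.ofReal (ballKernel (r, u) z) ∂sigmaSph d := fun u => by
    rw [cellMass, ENNReal.ofReal_add (Finset.sum_nonneg fun j _ => mul_nonneg (abs_nonneg _)
      (ballKernel_nonneg _ _)) (integral_nonneg fun z => ballKernel_nonneg _ _),
      ENNReal.ofReal_sum_of_nonneg fun j _ => mul_nonneg (abs_nonneg _) (ballKernel_nonneg _ _),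
      ofReal_integral_eq_lintegral_ofReal (integrable_ballKernel _).integrableOn
        (.of_forall fun z => ballKernel_nonneg _ _)]
    congr 1
    exact Finset.sum_congr rfl fun j _ => ENNReal.ofReal_mul (abs_nonneg _)
  have hmj : ∀ j, Measurable fun u => ENNReal.ofReal (ballKernel (r, u) (x j)) := fun j =>
    (hmeas.comp (measurable_id.prodMk measurable_const)).ennreal_ofReal
  simp only [e]
  rw [lintegral_add_left (Finset.measurable_sum _ fun j _ => (hmj j).const_mul _),
    lintegral_finsetSum _ fun j _ => (hmj j).const_mul _,
    lintegral_lintegral_swap hmeas.ennreal_ofReal.aemeasurable]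
  have h1 : ∑ j, ∫⁻ u, ENNReal.ofReal |a j| * ENNReal.ofReal (ballKernel (r, u) (x j)) ≤
      ENNReal.ofReal (K * (sigmaSph d).real Q) * V := by
    calc _ ≤ ∑ j, ENNReal.ofReal |a j| * V := Finset.sum_le_sum fun j _ => by
          rw [lintegral_const_mul _ (hmj j)]
          gcongr
          exact lintegral_ballKernel_le hr _
      _ = ENNReal.ofReal (∑ j, |a j|) * V := by
          rw [← Finset.sum_mul, ENNReal.ofReal_sum_of_nonneg fun j _ => abs_nonneg _]
      _ ≤ _ := by
          gcongr
          exact h.sum_abs_le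
  have h2 : ∫⁻ z in Q, (∫⁻ u : Amb d, ENNReal.ofReal (ballKernel (r, u) z)) ∂sigmaSph d ≤
      ENNReal.ofReal ((sigmaSph d).real Q) * V := by
    refine (lintegral_mono fun z => lintegral_ballKernel_le hr z).trans ?_
    rw [setLIntegral_const, mul_comm, measureReal_def, ENNReal.ofReal_toReal (measure_ne_top _ _)]
  refine (add_le_add h1 h2).trans ?_
  rw [← add_mul, ← ENNReal.ofReal_add hK measureReal_nonneg, add_one_mul]

/-- A majorant for the squared potential of a cell divided by the measure of the cell. -/
def cellMajorant (x : Fin n → Sph d) (K : ℝ) (y : Sph d) (ρ : ℝ) (Q : Set (Sph d))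
    (a : Fin n → ℝ) (ω : ℝ × Amb d) : ℝ :=
  if ω.1 < ρ then (K + 1) * cellMass x Q a ω
  else (K + 1) ^ 2 * (sigmaSph d).real Q * ((ρ / ω.1) ^ (d + 1)) ^ 2 *
    (ball (y : Amb d) (2 * ω.1)).indicator (fun _ => 1) ω.2

lemma cellMass_nonneg (x : Fin n → Sph d) (Q : Set (Sph d)) (a : Fin n → ℝ)
    (ω : ℝ × Amb d) : 0 ≤ cellMass x Q a ω :=
  (abs_nonneg _).trans (abs_cellCharge_le_cellMass x Q a ω)

lemma cellMajorant_nonneg (x : Fin n → Sph d) {K : ℝ} (hK : 0 ≤ K) (y : Sph d) (ρ : ℝ)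
    (Q : Set (Sph d)) (a : Fin n → ℝ) (ω : ℝ × Amb d) : 0 ≤ cellMajorant x K y ρ Q a ω := by
  unfold cellMajorant
  split_ifs
  · exact mul_nonneg (by linarith) (cellMass_nonneg x Q a ω)
  · have := measureReal_nonneg (μ := sigmaSph d) (s := Q)
    exact mul_nonneg (by positivity) (Set.indicator_nonneg (fun _ _ => zero_le_one) _)

lemma measurable_cellMajorant (x : Fin n → Sph d) (K : ℝ) (y : Sph d) (ρ : ℝ)
    (Q : Set (Sph d)) (a : Fin n → ℝ) (r : ℝ) :
    Measurable fun u => cellMajorant x K y ρ Q a (r, u) := by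
  unfold cellMajorant
  simp only
  split_ifs
  · exact (measurable_cellMass x Q a r).const_mul _
  · exact (measurable_const.indicator measurableSet_ball).const_mul _

lemma sq_cellCharge_le {x : Fin n → Sph d} {K : ℝ} (hK : 0 ≤ K) {y : Sph d} {ρ : ℝ}
    {Q : Set (Sph d)} {a : Fin n → ℝ} (h : IsCell x K y ρ Q a) {r : ℝ} (hr : 0 < r) (u : Amb d) :
    cellCharge x Q a (r, u) ^ 2 ≤
      (sigmaSph d).real Q * cellMajorant x K y ρ Q a (r, u) := by
  have hσ := measureReal_nonneg (μ := sigmaSph d) (s := Q)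
  have hρ := h.pos
  unfold cellMajorant
  rw [← sq_abs]
  simp only
  split_ifs with hrρ
  · calc _ = |cellCharge x Q a (r, u)| * |cellCharge x Q a (r, u)| := sq _
      _ ≤ ((K + 1) * (sigmaSph d).real Q) * cellMass x Q a (r, u) :=
          mul_le_mul (abs_cellCharge_le h _) (abs_cellCharge_le_cellMass x Q a _) (abs_nonneg _)
            (by positivity)
      _ = _ := by ring
  · by_cases hu : u ∈ ball (y : Amb d) (2 * r)
    · rw [Set.indicator_of_mem hu]
      calc _ ≤ ((K + 1) * (sigmaSph d).real Q * (ρ / r) ^ (d + 1)) ^ 2 :=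
            pow_le_pow_left₀ (abs_nonneg _) (abs_cellCharge_le_pow h (not_lt.1 hrρ) u) 2
        _ = _ := by ring
    · rw [cellCharge_eq_zero h hr, abs_zero]
      · rw [Set.indicator_of_notMem hu]
        simp
      · rw [mem_ball, not_lt] at hu
        linarith

lemma lintegral_cellMajorant_le {x : Fin n → Sph d} {K : ℝ} (hK : 0 ≤ K) {y : Sph d} {ρ : ℝ}
    {Q : Set (Sph d)} {a : Fin n → ℝ} (h : IsCell x K y ρ Q a) {r : ℝ} (hr : 0 < r) :
    ∫⁻ u, ENNReal.ofReal (cellMajorant x K y ρ Q a (r, u)) ≤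
      ENNReal.ofReal ((K + 1) ^ 2 * 2 ^ (d + 1) * (sigmaSph d).real Q * r ^ (d + 1) *
        (if r < ρ then 1 else ((ρ / r) ^ (d + 1)) ^ 2)) * volume (ball (0 : Amb d) 1) := by
  have hσ := measureReal_nonneg (μ := sigmaSph d) (s := Q)
  have h2 : (1 : ℝ) ≤ 2 ^ (d + 1) := one_le_pow₀ one_le_two
  unfold cellMajorant
  simp only
  split_ifs with hrρ
  · simp only [ENNReal.ofReal_mul (show 0 ≤ K + 1 by linarith)]
    rw [lintegral_const_mul _ (measurable_cellMass x Q a r).ennreal_ofReal]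
    calc _ ≤ _ := mul_le_mul_right (lintegral_cellMass_le h hr) _
      _ = ENNReal.ofReal ((K + 1) * ((K + 1) * (sigmaSph d).real Q) * r ^ (d + 1)) *
          volume (ball (0 : Amb d) 1) := by
        simp only [mul_assoc, ENNReal.ofReal_mul (show 0 ≤ K + 1 by linarith),
          ENNReal.ofReal_mul hσ]
      _ ≤ _ := by
        refine mul_le_mul_left (ENNReal.ofReal_le_ofReal ?_) _
        rw [mul_one]
        have : 0 ≤ (K + 1) ^ 2 * (sigmaSph d).real Q * r ^ (d + 1) := by positivity
        nlinarith
  · set A := (K + 1) ^ 2 * (sigmaSph d).real Q * ((ρ / r) ^ (d + 1)) ^ 2 with hA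
    have hA0 : 0 ≤ A := by positivity
    have e : ∀ u : Amb d, ENNReal.ofReal
        (A * (ball (y : Amb d) (2 * r)).indicator (fun _ => (1 : ℝ)) u) =
        ENNReal.ofReal A * (ball (y : Amb d) (2 * r)).indicator (fun _ => 1) u := fun u => by
      by_cases hu : u ∈ ball (y : Amb d) (2 * r)
      · simp only [Set.indicator_of_mem hu, mul_one]
      · simp only [Set.indicator_of_notMem hu, mul_zero, ENNReal.ofReal_zero]
    simp only [e]
    rw [lintegral_const_mul _ (measurable_const.indicator measurableSet_ball),
      lintegral_indicator_const measurableSet_ball, one_mul, Measure.addHaar_ball_center,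
      volume_ball_zero _ (by positivity), ← mul_assoc, ← ENNReal.ofReal_mul hA0]
    refine mul_le_mul_left (ENNReal.ofReal_le_ofReal (le_of_eq ?_)) _
    rw [hA, mul_pow 2 r]
    ring

end CellMajorants

section CellEnergy

variable {d n : ℕ}

open scoped ENNReal

lemma lintegral_scale_le (d : ℕ) {ρ : ℝ} (hρ : 0 < ρ) :
    ∫⁻ r in Set.Ioi (0 : ℝ), ENNReal.ofReal (max r ρ ^ d *
      (if r < ρ then 1 else ((ρ / r) ^ (d + 1)) ^ 2)) ≤ ENNReal.ofReal (2 * ρ ^ (d + 1)) := by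
  rw [← Set.Ioc_union_Ioi_eq_Ioi hρ.le, lintegral_union measurableSet_Ioi
    (Set.Ioc_disjoint_Ioi le_rfl), two_mul, ENNReal.ofReal_add (by positivity) (by positivity)]
  refine add_le_add ?_ ?_
  · calc _ ≤ ∫⁻ _ in Set.Ioc (0 : ℝ) ρ, ENNReal.ofReal (ρ ^ d) := by
          refine setLIntegral_mono measurable_const fun r hr => ENNReal.ofReal_le_ofReal ?_
          rw [max_eq_right hr.2]
          refine mul_le_of_le_one_right (by positivity) ?_
          split_ifs with h
          · exact le_rfl
          · rw [le_antisymm hr.2 (not_lt.1 h), div_self hρ.ne']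
            simp
      _ = _ := by
          rw [setLIntegral_const, Real.volume_Ioc, sub_zero, ← ENNReal.ofReal_mul (by positivity),
            pow_succ]
  · calc _ ≤ ∫⁻ r in Set.Ioi ρ, ENNReal.ofReal (ρ ^ (d + 2) * r ^ (-2 : ℝ)) := by
          refine setLIntegral_mono (by fun_prop) fun r hr => ENNReal.ofReal_le_ofReal ?_
          have hr : ρ < r := hr
          have hr0 : 0 < r := hρ.trans hr
          rw [max_eq_left hr.le, if_neg hr.le.not_gt, Real.rpow_neg hr0.le]
          norm_cast
          have h1 : (ρ / r) ^ d ≤ 1 := pow_le_one₀ (by positivity) ((div_le_one hr0).2 hr.le)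
          have h2 : r ^ d * ((ρ / r) ^ (d + 1)) ^ 2 =
              (ρ ^ (d + 2) * (r ^ 2)⁻¹) * (ρ / r) ^ d := by
            rw [pow_succ (ρ / r) d, mul_pow, div_pow ρ r 2, div_pow ρ r d]
            field_simp
            ring
          rw [h2]
          exact mul_le_of_le_one_right (by positivity) h1
      _ = _ := by
          rw [← ofReal_integral_eq_lintegral_ofReal
            ((integrableOn_Ioi_rpow_of_lt (by norm_num) hρ).const_mul _)
            ((ae_restrict_mem measurableSet_Ioi).mono fun r hr => by
              have : 0 < r := hρ.trans hr
              positivity), integral_const_mul, integral_Ioi_rpow_of_lt (by norm_num) hρ]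
          congr 1
          rw [show (-2 + 1 : ℝ) = -1 by norm_num, Real.rpow_neg_one]
          field_simp
          ring

lemma measurable_scale (ρ : ℝ) : Measurable fun r : ℝ => ENNReal.ofReal (max r ρ ^ d *
    (if r < ρ then 1 else ((ρ / r) ^ (d + 1)) ^ 2)) :=
  Measurable.ennreal_ofReal (Measurable.mul (by fun_prop)
    (Measurable.ite measurableSet_Iio measurable_const (by fun_prop)))

variable {ι : Type} {x : Fin n → Sph d} {K : ℝ} {y : ι → Sph d} {ρ : ι → ℝ}
  {Q : ι → Set (Sph d)} {a : ι → Fin n → ℝ}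

lemma sum_active_le (h : ∀ i, IsCell x K (y i) (ρ i) (Q i) (a i))
    (hd : Pairwise (Function.onFun Disjoint Q)) (hρ : ∀ i k, ρ i ≤ ρ k + dist (y i) (y k))
    {r : ℝ} (hr : 0 < r) (A : Finset ι) (u : Amb d)
    (hA : ∀ i ∈ A, dist u (y i) < r + ρ i / 4) :
    ∑ i ∈ A, (sigmaSph d).real (Q i) / max r (ρ i) ^ d ≤ 2 ^ (d + 1) * 25 ^ d := by
  rcases A.eq_empty_or_nonempty with rfl | ⟨k, hk⟩
  · simp only [Finset.sum_empty]
    positivity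
  set M := max r (ρ k) with hM
  have hMr : r ≤ M := le_max_left _ _
  have hMk : ρ k ≤ M := le_max_right _ _
  have hM0 : 0 < M := hr.trans_le hMr
  have hdist : ∀ i ∈ A, dist (y i) (y k) < 2 * r + (ρ i + ρ k) / 4 := fun i hi => by
    have h1 : dist (y i : Amb d) (y k) ≤ dist u (y i) + dist u (y k) := dist_triangle_left _ _ _
    have h2 : dist (y i) (y k) = dist (y i : Amb d) (y k) := rfl
    linarith [hA i hi, hA k hk]
  have hρM : ∀ i ∈ A, ρ i ≤ 5 * M := fun i hi => by
    linarith [hdist i hi, hρ i k]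
  have hMi : ∀ i ∈ A, M ≤ 5 * max r (ρ i) := fun i hi => by
    have h1 := hdist i hi
    have h2 := hρ k i
    rw [dist_comm] at h2
    have h3 := le_max_left r (ρ i)
    have h4 := le_max_right r (ρ i)
    refine max_le (by linarith) (by linarith)
  have hsub : (⋃ i ∈ A, Q i) ⊆ ball (y k) (5 * M) := by
    refine Set.iUnion₂_subset fun i hi z hz => ?_
    have h1 := mem_closedBall.1 ((h i).subset hz)
    have h2 := dist_triangle z (y i) (y k)
    rw [mem_ball]
    have h3 := hdist i hi
    have h4 : ρ i ≤ ρ k + dist (y i) (y k) := hρ i k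
    linarith
  have hmeas : ∑ i ∈ A, (sigmaSph d).real (Q i) ≤ 2 ^ (d + 1) * (5 * M) ^ d := by
    rw [← measureReal_biUnion_finset (fun i _ j _ hij => hd hij) fun i _ => (h i).measurableSet]
    refine ENNReal.toReal_le_of_le_ofReal (by positivity) ?_
    exact (measure_mono hsub).trans (sigmaSph_ball_le _ (by positivity))
  calc ∑ i ∈ A, (sigmaSph d).real (Q i) / max r (ρ i) ^ d
      ≤ ∑ i ∈ A, (sigmaSph d).real (Q i) * (5 ^ d / M ^ d) := by
        refine Finset.sum_le_sum fun i hi => ?_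
        rw [div_eq_mul_inv]
        refine mul_le_mul_of_nonneg_left ?_ measureReal_nonneg
        have h0 : 0 < max r (ρ i) := lt_max_of_lt_left hr
        rw [inv_eq_one_div, div_le_div_iff₀ (by positivity) (by positivity), one_mul, ← mul_pow]
        exact pow_le_pow_left₀ hM0.le (hMi i hi) _
    _ ≤ (2 ^ (d + 1) * (5 * M) ^ d) * (5 ^ d / M ^ d) := by
        rw [← Finset.sum_mul]
        gcongr
    _ = _ := by
        rw [show (25 : ℝ) = 5 * 5 by norm_num, mul_pow, mul_pow]
        field_simp

variable [Fintype ι]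

lemma sum_cells_eq_one (h : ∀ i, IsCell x K (y i) (ρ i) (Q i) (a i))
    (hd : Pairwise (Function.onFun Disjoint Q)) (hQ : ⋃ i, Q i = Set.univ) :
    ∑ j, (∑ i, a i) j = 1 := by
  simp only [Finset.sum_apply]
  rw [Finset.sum_comm]
  have h1 : ∀ i, ∑ j, a i j = (sigmaSph d).real (Q i) := fun i => by
    have := (h i).exact _ (one_mem_circlePoly _)
    simpa using this
  simp only [h1]
  rw [← measureReal_iUnion_fintype hd fun i => (h i).measurableSet, hQ, probReal_univ]

lemma charge_eq_sum_cellCharge (h : ∀ i, IsCell x K (y i) (ρ i) (Q i) (a i))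
    (hd : Pairwise (Function.onFun Disjoint Q)) (hQ : ⋃ i, Q i = Set.univ) (ω : ℝ × Amb d) :
    ∑ j, (∑ i, a i) j * ballKernel ω (x j) -
      (∑ j, (∑ i, a i) j) * ∫ z, ballKernel ω z ∂sigmaSph d = ∑ i, cellCharge x (Q i) (a i) ω := by
  rw [sum_cells_eq_one h hd hQ, one_mul]
  simp only [cellCharge, Finset.sum_sub_distrib]
  rw [← integral_iUnion_fintype (fun i => (h i).measurableSet) hd
    fun i => (integrable_ballKernel ω).integrableOn, hQ, setIntegral_univ, Finset.sum_comm]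
  simp only [Finset.sum_apply, Finset.sum_mul]

lemma sq_charge_le (hK : 0 ≤ K) (h : ∀ i, IsCell x K (y i) (ρ i) (Q i) (a i))
    (hd : Pairwise (Function.onFun Disjoint Q)) (hρ : ∀ i k, ρ i ≤ ρ k + dist (y i) (y k))
    {r : ℝ} (hr : 0 < r) (u : Amb d) :
    (∑ i, cellCharge x (Q i) (a i) (r, u)) ^ 2 ≤ 2 ^ (d + 1) * 25 ^ d *
      ∑ i, max r (ρ i) ^ d * cellMajorant x K (y i) (ρ i) (Q i) (a i) (r, u) := by
  classical
  set A := Finset.univ.filter fun i => dist u (y i) < r + ρ i / 4 with hA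
  have hM : ∀ i, 0 < max r (ρ i) := fun i => lt_max_of_lt_left hr
  have hnn : ∀ i, 0 ≤ max r (ρ i) ^ d * cellMajorant x K (y i) (ρ i) (Q i) (a i) (r, u) :=
    fun i => mul_nonneg (pow_nonneg (hM i).le _) (cellMajorant_nonneg x hK _ _ _ _ _)
  have h1 : ∑ i, cellCharge x (Q i) (a i) (r, u) = ∑ i ∈ A, cellCharge x (Q i) (a i) (r, u) := by
    refine (Finset.sum_subset (Finset.subset_univ _) fun i _ hi => ?_).symm
    refine cellCharge_eq_zero (h i) hr (not_lt.1 fun hlt => hi ?_)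
    simp [hA, hlt]
  rw [h1]
  calc _ ≤ (∑ i ∈ A, (sigmaSph d).real (Q i) / max r (ρ i) ^ d) *
        ∑ i ∈ A, max r (ρ i) ^ d * cellMajorant x K (y i) (ρ i) (Q i) (a i) (r, u) := by
        refine Finset.sum_sq_le_sum_mul_sum_of_sq_le_mul _ (fun i _ => ?_) (fun i _ => hnn i)
          fun i _ => ?_
        · exact div_nonneg measureReal_nonneg (pow_nonneg (hM i).le _)
        · refine (sq_cellCharge_le hK (h i) hr u).trans (le_of_eq ?_)
          have := (pow_pos (hM i) d).ne'
          field_simp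
    _ ≤ _ := by
        refine mul_le_mul (sum_active_le h hd hρ hr A u fun i hi => (Finset.mem_filter.1 hi).2)
          (Finset.sum_le_sum_of_subset_of_nonneg (Finset.subset_univ _) fun i _ _ => hnn i)
          (Finset.sum_nonneg fun i _ => hnn i) (by positivity)

lemma chargeEnergy_cells_le (hK : 0 ≤ K) (h : ∀ i, IsCell x K (y i) (ρ i) (Q i) (a i))
    (hd : Pairwise (Function.onFun Disjoint Q)) (hQ : ⋃ i, Q i = Set.univ)
    (hρ : ∀ i k, ρ i ≤ ρ k + dist (y i) (y k)) :
    chargeEnergy (ballMeasure d) ballKernel x (∑ i, a i) ≤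
      ENNReal.ofReal (2 ^ (d + 1) * 25 ^ d * ((K + 1) ^ 2 * 2 ^ (d + 1)) * 2) *
        volume (ball (0 : Amb d) 1) *
        ENNReal.ofReal (∑ i, (sigmaSph d).real (Q i) * ρ i ^ (d + 1)) := by
  have hK1 : 0 ≤ K + 1 := by linarith
  set B : ℝ := 2 ^ (d + 1) * 25 ^ d with hB
  have hB0 : 0 ≤ B := by positivity
  set D : ℝ := (K + 1) ^ 2 * 2 ^ (d + 1) with hD
  have hD0 : 0 ≤ D := by positivity
  set V := volume (ball (0 : Amb d) 1)
  have hm := measurable_charge (measurable_ballKernel (d := d)) x (∑ i, a i)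
  rw [chargeEnergy, lintegral_ballMeasure ((hm.pow_const 2).ennreal_ofReal)]
  have key : ∀ r ∈ Set.Ioi (0 : ℝ), ENNReal.ofReal ((r ^ (d + 1))⁻¹) *
      ∫⁻ u : Amb d, ENNReal.ofReal ((∑ j, (∑ i, a i) j * ballKernel (r, u) (x j) -
        (∑ j, (∑ i, a i) j) * ∫ z, ballKernel (r, u) z ∂sigmaSph d) ^ 2) ≤
      ∑ i, ENNReal.ofReal (B * D * (sigmaSph d).real (Q i)) * V *
        ENNReal.ofReal (max r (ρ i) ^ d *
          (if r < ρ i then 1 else ((ρ i / r) ^ (d + 1)) ^ 2)) := by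
    intro r hr
    have hr : 0 < r := hr
    have hM : ∀ i, 0 < max r (ρ i) := fun i => lt_max_of_lt_left hr
    have hnn : ∀ i u, 0 ≤ max r (ρ i) ^ d * cellMajorant x K (y i) (ρ i) (Q i) (a i) (r, u) :=
      fun i u => mul_nonneg (pow_nonneg (hM i).le _) (cellMajorant_nonneg x hK _ _ _ _ _)
    have hmm : ∀ i, Measurable fun u =>
        ENNReal.ofReal (cellMajorant x K (y i) (ρ i) (Q i) (a i) (r, u)) := fun i =>
      (measurable_cellMajorant x K (y i) (ρ i) (Q i) (a i) r).ennreal_ofReal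
    calc _ ≤ ENNReal.ofReal ((r ^ (d + 1))⁻¹) * ∫⁻ u : Amb d, ∑ i,
          ENNReal.ofReal (B * max r (ρ i) ^ d) *
            ENNReal.ofReal (cellMajorant x K (y i) (ρ i) (Q i) (a i) (r, u)) := by
          refine mul_le_mul_right (lintegral_mono fun u => ?_) _
          beta_reduce
          rw [charge_eq_sum_cellCharge h hd hQ]
          refine (ENNReal.ofReal_le_ofReal (sq_charge_le hK h hd hρ hr u)).trans (le_of_eq ?_)
          rw [ENNReal.ofReal_mul hB0, ENNReal.ofReal_sum_of_nonneg fun i _ => hnn i u,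
            Finset.mul_sum]
          refine Finset.sum_congr rfl fun i _ => ?_
          rw [← ENNReal.ofReal_mul hB0, ← mul_assoc, ENNReal.ofReal_mul]
          exact mul_nonneg hB0 (pow_nonneg (hM i).le _)
      _ ≤ ENNReal.ofReal ((r ^ (d + 1))⁻¹) * ∑ i, ENNReal.ofReal (B * max r (ρ i) ^ d) *
          (ENNReal.ofReal (D * (sigmaSph d).real (Q i) * r ^ (d + 1) *
            (if r < ρ i then 1 else ((ρ i / r) ^ (d + 1)) ^ 2)) * V) := by
          refine mul_le_mul_right ?_ _
          rw [lintegral_finsetSum _ fun i _ => (hmm i).const_mul _]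
          refine Finset.sum_le_sum fun i _ => ?_
          rw [lintegral_const_mul _ (hmm i)]
          exact mul_le_mul_right (lintegral_cellMajorant_le hK (h i) hr) _
      _ = _ := by
          rw [Finset.mul_sum]
          refine Finset.sum_congr rfl fun i _ => ?_
          set κ : ℝ := if r < ρ i then 1 else ((ρ i / r) ^ (d + 1)) ^ 2
          have hκ : 0 ≤ κ := by
            simp only [κ]
            split_ifs <;> positivity
          have hσ := measureReal_nonneg (μ := sigmaSph d) (s := Q i)
          have hMi := hM i
          rw [← mul_assoc, ← mul_assoc, ← ENNReal.ofReal_mul (by positivity),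
            ← ENNReal.ofReal_mul (by positivity), mul_right_comm _ V,
            ← ENNReal.ofReal_mul (by positivity)]
          congr 2
          field_simp
  refine (setLIntegral_mono' measurableSet_Ioi key).trans ?_
  rw [lintegral_finsetSum _ fun i _ => (measurable_scale (ρ i)).const_mul _,
    ENNReal.ofReal_sum_of_nonneg fun i _ => ?_, Finset.mul_sum]
  · refine Finset.sum_le_sum fun i _ => ?_
    have hσ := measureReal_nonneg (μ := sigmaSph d) (s := Q i)
    have hρi := (h i).pos
    rw [lintegral_const_mul _ (measurable_scale (ρ i))]
    refine (mul_le_mul_right (lintegral_scale_le d hρi) _).trans (le_of_eq ?_)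
    rw [mul_right_comm _ V, mul_right_comm _ V, ← ENNReal.ofReal_mul (by positivity),
      ← ENNReal.ofReal_mul (by positivity)]
    congr 2
    ring
  · have hρi := (h i).pos
    positivity

end CellEnergy

section Quadrature

variable {d n : ℕ}

open scoped ENNReal

lemma exists_measurable_partition (d : ℕ) {ε : ℝ} (hε : 0 < ε) :
    ∃ (N : ℕ) (y : Fin N → Sph d) (Q : Fin N → Set (Sph d)), (∀ i, MeasurableSet (Q i)) ∧
      Pairwise (Function.onFun Disjoint Q) ∧ ⋃ i, Q i = Set.univ ∧ ∀ i, Q i ⊆ ball (y i) ε := by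
  obtain ⟨t, -, htf, ht⟩ := finite_cover_balls_of_compact (isCompact_univ (X := Sph d)) hε
  obtain ⟨N, y, -, rfl⟩ := htf.fin_param
  refine ⟨N, y, disjointed fun i => ball (y i) ε, fun i => ?_, disjoint_disjointed _, ?_,
    disjointed_subset _⟩
  · rw [disjointed_apply, Finset.sup_set_eq_biUnion]
    exact measurableSet_ball.diff (Finset.measurableSet_biUnion _ fun _ _ => measurableSet_ball)
  · rw [iUnion_disjointed]
    rw [Set.biUnion_range] at ht
    exact Set.univ_subset_iff.1 ht

lemma sum_measureReal_mul_pow_le {N : ℕ} {y : Fin N → Sph d} {Q : Fin N → Set (Sph d)}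
    (hQm : ∀ i, MeasurableSet (Q i)) (hQd : Pairwise (Function.onFun Disjoint Q))
    (hQ : ⋃ i, Q i = Set.univ) {ρ : Sph d → ℝ} (hρ : LipschitzWith 1 ρ) (h0 : ∀ z, 0 < ρ z)
    (hQy : ∀ i, Q i ⊆ closedBall (y i) (ρ (y i) / 8)) (m : ℕ) :
    ENNReal.ofReal (∑ i, (sigmaSph d).real (Q i) * ρ (y i) ^ m) ≤
      ENNReal.ofReal (2 ^ m) * ∫⁻ z, ENNReal.ofReal (ρ z ^ m) ∂sigmaSph d := by
  rw [← setLIntegral_univ, ← hQ, lintegral_iUnion hQm hQd, tsum_fintype, Finset.mul_sum,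
    ENNReal.ofReal_sum_of_nonneg fun i _ => mul_nonneg measureReal_nonneg
      (pow_nonneg (h0 _).le _)]
  refine Finset.sum_le_sum fun i _ => ?_
  rw [← lintegral_const_mul' _ _ ENNReal.ofReal_ne_top, mul_comm ((sigmaSph d).real (Q i)),
    ENNReal.ofReal_mul (pow_nonneg (h0 _).le _), measureReal_def,
    ENNReal.ofReal_toReal (measure_ne_top _ _), ← setLIntegral_const]
  refine setLIntegral_mono' (hQm i) fun z hz => ?_
  rw [← ENNReal.ofReal_mul (by positivity), ← mul_pow]
  refine ENNReal.ofReal_le_ofReal (pow_le_pow_left₀ (h0 _).le ?_ _)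
  have h1 := mem_closedBall'.1 (hQy i hz)
  have h2 := hρ.le_add_mul (y i) z
  rw [NNReal.coe_one, one_mul] at h2
  linarith [h0 (y i)]

lemma exists_sphDisc_sq_le_of_local_scale (d : ℕ) : ∃ η C : ℝ, 0 < η ∧ η ≤ 1 ∧ 0 < C ∧
    ∀ (n : ℕ) (x : Fin n → Sph d) (ρ : Sph d → ℝ) (τ : ℝ), LipschitzWith 1 ρ → 0 < τ →
      (∀ y, τ ≤ ρ y) → (∀ y, ρ y ≤ 1) →
      (∀ y, ∀ z ∈ closedBall y (ρ y / 8), ∃ j, dist z (x j) ≤ η * ρ y) →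
      ∃ w : Fin n → ℝ, ENNReal.ofReal (sphDisc x w ^ 2) ≤
        ENNReal.ofReal C * ∫⁻ z, ENNReal.ofReal (ρ z ^ (d + 1)) ∂sigmaSph d := by
  obtain ⟨η, K, hη, hη1, hK, H⟩ := exists_local_weights d (d + 1)
  obtain ⟨k, hk, hcap⟩ := exists_chargeEnergy_cap_eq d
  set D : ℝ := 2 ^ (d + 1) * 25 ^ d * ((K + 1) ^ 2 * 2 ^ (d + 1)) * 2 with hD
  set V : ℝ := (volume (ball (0 : Amb d) 1)).toReal with hV
  have hV0 : 0 < V := ENNReal.toReal_pos (measure_ball_pos _ _ one_pos).ne' measure_ball_lt_top.ne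
  have hVe : volume (ball (0 : Amb d) 1) = ENNReal.ofReal V :=
    (ENNReal.ofReal_toReal measure_ball_lt_top.ne).symm
  refine ⟨η, k * D * V * 2 ^ (d + 1), hη, hη1, by positivity, ?_⟩
  intro n x ρ τ hρ hτ hτρ hρ1 hdata
  have h0 : ∀ z, 0 < ρ z := fun z => hτ.trans_le (hτρ z)
  obtain ⟨N, y, Q, hQm, hQd, hQ, hQy⟩ := exists_measurable_partition d (ε := τ / 8) (by positivity)
  have hQy' : ∀ i, Q i ⊆ closedBall (y i) (ρ (y i) / 8) := fun i => (hQy i).trans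
    (ball_subset_closedBall.trans (closedBall_subset_closedBall (by linarith [hτρ (y i)])))
  choose a ha1 ha2 ha3 using fun i => H n x (y i) (ρ (y i)) (Q i) (h0 _) (hρ1 _) (hQm i) (hQy' i)
    (hdata (y i))
  have hcell : ∀ i, IsCell x K (y i) (ρ (y i)) (Q i) (a i) := fun i =>
    ⟨h0 _, hQm i, hQy' i, ha1 i, ha2 i, ha3 i⟩
  have hE := chargeEnergy_cells_le hK.le hcell hQd hQ fun i l => by
    have := hρ.le_add_mul (y i) (y l)
    rwa [NNReal.coe_one, one_mul] at this
  have hS := sum_measureReal_mul_pow_le hQm hQd hQ hρ h0 hQy' (d + 1)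
  obtain ⟨z₀⟩ : Nonempty (Sph d) := (sigmaSph d).nonempty_of_neZero
  refine ⟨∑ i, a i, ?_⟩
  rw [ofReal_sphDisc_sq_eq x _ z₀, sum_cells_eq_one hcell hQd hQ, hcap]
  simp only [sub_self, zero_mul, ne_eq, OfNat.ofNat_ne_zero, not_false_eq_true, zero_pow,
    ENNReal.ofReal_zero, lintegral_zero, add_zero]
  refine (mul_le_mul_right (hE.trans (mul_le_mul_right hS _)) _).trans (le_of_eq ?_)
  rw [hVe, ENNReal.ofReal_mul (q := 2 ^ (d + 1)) (by positivity),
    ENNReal.ofReal_mul (q := V) (by positivity), ENNReal.ofReal_mul hk.le]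
  ring

end Quadrature

section Scales

variable {d n : ℕ}

open scoped ENNReal

/-- The constant in the lower bound for the measure of balls on the sphere. -/
def ballLower (d : ℕ) : ℝ := ((2 : ℝ) ^ d * (2 ^ (d + 1) + (d + 1)))⁻¹

lemma ballLower_pos : 0 < ballLower d := by unfold ballLower; positivity

lemma lintegral_pow_le_of_maximal {L : ℝ} (hL : 1 ≤ L) {δ ρ : Sph d → ℝ} (hδ : LipschitzWith 1 δ)
    (h0 : ∀ z, 0 < δ z) (hL1 : ∀ z, L * δ z ≤ 1) (hρ0 : ∀ y, 0 < ρ y) (Z : Sph d → Sph d)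
    (hZ : ∀ y, ρ y = L * δ (Z y) - dist (Z y) y) :
    ∫⁻ y, ENNReal.ofReal (ρ y ^ (d + 1)) ∂sigmaSph d ≤
      ENNReal.ofReal (L ^ (d + 1) * 2 ^ (d + 1) / ballLower d * (2 ^ (d + 1) * (3 * L) ^ d)) *
        ∫⁻ z, ENNReal.ofReal (δ z ^ (d + 1)) ∂sigmaSph d := by
  have hL0 : 0 < L := by linarith
  have hc := ballLower_pos (d := d)
  set C₁ := L ^ (d + 1) * 2 ^ (d + 1) / ballLower d with hC₁
  have hC₁0 : 0 ≤ C₁ := by positivity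
  have hδc := hδ.continuous
  let S : Set (Sph d × Sph d) := {p | dist p.2 p.1 < 3 * L * δ p.2}
  have hS : MeasurableSet S := measurableSet_lt (by fun_prop)
    ((hδc.measurable.comp measurable_snd).const_mul _)
  let G : Sph d → Sph d → ℝ≥0∞ := fun y z => ENNReal.ofReal (δ z) * S.indicator 1 (y, z)
  have hG : Measurable (Function.uncurry G) :=
    (hδc.measurable.comp measurable_snd).ennreal_ofReal.mul (measurable_one.indicator hS)
  have h1 : ∀ y, ENNReal.ofReal (ρ y ^ (d + 1)) ≤
      ENNReal.ofReal C₁ * ∫⁻ z, G y z ∂sigmaSph d := by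
    intro y
    set z := Z y
    set s := δ z
    have hs : 0 < s := h0 z
    have hρs : ρ y ≤ L * s := by
      rw [hZ]; linarith [dist_nonneg (x := Z y) (y := y)]
    have hdy : dist z y < L * s := by
      have := hρ0 y
      rw [hZ] at this
      linarith
    have hs2 : s / 2 ≤ 2 := by nlinarith [hL1 z]
    calc ENNReal.ofReal (ρ y ^ (d + 1))
        ≤ ENNReal.ofReal (C₁ * (s / 2 * (ballLower d * (s / 2) ^ d))) := by
          refine ENNReal.ofReal_le_ofReal ((pow_le_pow_left₀ (hρ0 y).le hρs _).trans (le_of_eq ?_))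
          rw [hC₁, mul_pow, div_pow, pow_succ s, pow_succ 2]
          field_simp
      _ = ENNReal.ofReal C₁ *
          (ENNReal.ofReal (s / 2) * ENNReal.ofReal (ballLower d * (s / 2) ^ d)) := by
          rw [ENNReal.ofReal_mul hC₁0, ENNReal.ofReal_mul (by positivity)]
      _ ≤ ENNReal.ofReal C₁ * (ENNReal.ofReal (s / 2) * sigmaSph d (ball z (s / 2))) := by
          gcongr
          exact sigmaSph_ball_ge z (by positivity) hs2
      _ ≤ _ := by
          gcongr
          rw [← setLIntegral_const]
          refine (setLIntegral_mono' measurableSet_ball fun p hp => ?_).trans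
            (setLIntegral_le_lintegral (ball z (s / 2)) _)
          have hp' := mem_ball.1 hp
          have h2 := hδ.le_add_mul z p
          rw [NNReal.coe_one, one_mul, dist_comm] at h2
          have h3 : s / 2 ≤ δ p := by
            have : δ z = s := rfl
            linarith
          have h4 : dist p y < 3 * L * δ p := by
            have h5 := dist_triangle p z y
            nlinarith
          have h6 : (y, p) ∈ S := h4
          simp only [G, Set.indicator_of_mem h6, Pi.one_apply, mul_one]
          exact ENNReal.ofReal_le_ofReal h3
  calc _ ≤ ∫⁻ y, ENNReal.ofReal C₁ * ∫⁻ z, G y z ∂sigmaSph d ∂sigmaSph d := lintegral_mono h1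
    _ = ENNReal.ofReal C₁ * ∫⁻ z, ∫⁻ y, G y z ∂sigmaSph d ∂sigmaSph d := by
        rw [lintegral_const_mul' _ _ ENNReal.ofReal_ne_top, lintegral_lintegral_swap hG.aemeasurable]
    _ ≤ ENNReal.ofReal C₁ * ∫⁻ z, ENNReal.ofReal (2 ^ (d + 1) * (3 * L) ^ d) *
          ENNReal.ofReal (δ z ^ (d + 1)) ∂sigmaSph d := by
        gcongr with z
        have hz := h0 z
        have e : ∀ y, G y z = (ball z (3 * L * δ z)).indicator
            (fun _ => ENNReal.ofReal (δ z)) y := fun y => by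
          by_cases h : y ∈ ball z (3 * L * δ z)
          · have h' : (y, z) ∈ S := mem_ball'.1 h
            simp only [G, Set.indicator_of_mem h, Set.indicator_of_mem h', Pi.one_apply, mul_one]
          · have h' : (y, z) ∉ S := fun h' => h (mem_ball'.2 h')
            simp only [G, Set.indicator_of_notMem h, Set.indicator_of_notMem h', mul_zero]
        simp only [e]
        rw [lintegral_indicator_const measurableSet_ball]
        calc _ ≤ ENNReal.ofReal (δ z) * ENNReal.ofReal (2 ^ (d + 1) * (3 * L * δ z) ^ d) := by
              gcongr
              exact sigmaSph_ball_le z (by positivity)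
          _ = _ := by
              rw [← ENNReal.ofReal_mul hz.le, ← ENNReal.ofReal_mul (by positivity)]
              congr 1
              ring
    _ = _ := by
        rw [lintegral_const_mul' _ _ ENNReal.ofReal_ne_top, ← mul_assoc,
          ← ENNReal.ofReal_mul hC₁0]

lemma le_lintegral_pow_of_lipschitz {δ : Sph d → ℝ} (hδ : LipschitzWith 1 δ)
    {s : ℝ} (hs : 0 < s) (hs2 : s ≤ 2) {z₀ : Sph d} (hz : 2 * s ≤ δ z₀) :
    ENNReal.ofReal (s ^ (d + 1) * (ballLower d * s ^ d)) ≤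
      ∫⁻ z, ENNReal.ofReal (δ z ^ (d + 1)) ∂sigmaSph d := by
  rw [ENNReal.ofReal_mul (by positivity)]
  calc _ ≤ ENNReal.ofReal (s ^ (d + 1)) * sigmaSph d (ball z₀ s) := by
        gcongr
        exact sigmaSph_ball_ge z₀ hs hs2
    _ ≤ _ := by
        rw [← setLIntegral_const]
        refine (setLIntegral_mono' measurableSet_ball fun p hp => ?_).trans
          (setLIntegral_le_lintegral (ball z₀ s) _)
        have h2 := hδ.le_add_mul z₀ p
        rw [NNReal.coe_one, one_mul, dist_comm] at h2
        have := mem_ball.1 hp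
        exact ENNReal.ofReal_le_ofReal (pow_le_pow_left₀ hs.le (by linarith) _)

lemma sphDisc_zero_sq_le (x : Fin n → Sph d) :
    ENNReal.ofReal (sphDisc x 0 ^ 2) ≤ ENNReal.ofReal 2 := by
  obtain ⟨z₀⟩ : Nonempty (Sph d) := (sigmaSph d).nonempty_of_neZero
  rw [ofReal_sphDisc_sq_eq x 0 z₀]
  simp only [chargeEnergy, Pi.zero_apply, zero_mul, Finset.sum_const_zero, sub_self, ne_eq,
    OfNat.ofNat_ne_zero, not_false_eq_true, zero_pow, ENNReal.ofReal_zero, lintegral_zero, zero_add]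
  calc _ ≤ ∫⁻ _ in Set.Icc (-1 : ℝ) 1, 1 := by
        refine lintegral_mono fun t => ENNReal.ofReal_le_one.2 ?_
        have h1 : (sigmaSph d (sphCap z₀ t)).toReal ≤ 1 := measureReal_le_one
        have h2 : 0 ≤ (sigmaSph d (sphCap z₀ t)).toReal := ENNReal.toReal_nonneg
        nlinarith
    _ = _ := by
        rw [setLIntegral_const, Real.volume_Icc, one_mul]
        norm_num

lemma exists_sphDisc_sq_le (d : ℕ) : ∃ C : ℝ, 0 < C ∧
    ∀ (n : ℕ) (x : Fin n → Sph d) (δ : Sph d → ℝ) (τ : ℝ), LipschitzWith 1 δ → 0 < τ →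
      (∀ y, τ ≤ δ y) → (∀ z, ∃ j, dist z (x j) ≤ δ z) →
      ∃ w : Fin n → ℝ, ENNReal.ofReal (sphDisc x w ^ 2) ≤
        ENNReal.ofReal C * ∫⁻ z, ENNReal.ofReal (δ z ^ (d + 1)) ∂sigmaSph d := by
  obtain ⟨η, C, hη, hη1, hC, H⟩ := exists_sphDisc_sq_le_of_local_scale d
  have hc := ballLower_pos (d := d)
  set L : ℝ := 2 / η with hL
  have hL2 : 2 ≤ L := by
    rw [hL, le_div_iff₀ hη]; linarith
  have hL0 : 0 < L := by linarith
  set C₁ : ℝ := L ^ (d + 1) * 2 ^ (d + 1) / ballLower d * (2 ^ (d + 1) * (3 * L) ^ d) with hC₁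
  have hC₁0 : 0 < C₁ := by positivity
  set s : ℝ := (2 * L)⁻¹ with hs
  have hs0 : 0 < s := by positivity
  have hs2 : s ≤ 2 := by
    rw [hs, inv_le_comm₀ (by positivity) (by norm_num)]
    linarith
  set c₁ : ℝ := s ^ (d + 1) * (ballLower d * s ^ d) with hc₁
  have hc₁0 : 0 < c₁ := by positivity
  refine ⟨C * C₁ + 2 / c₁, by positivity, ?_⟩
  intro n x δ τ hδ hτ hτδ hx
  have h0 : ∀ z, 0 < δ z := fun z => hτ.trans_le (hτδ z)
  by_cases hbig : ∃ z₀, 1 < L * δ z₀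
  · obtain ⟨z₀, hz₀⟩ := hbig
    refine ⟨0, (sphDisc_zero_sq_le x).trans ?_⟩
    have h2 : 2 * s ≤ δ z₀ := by
      have : 2 * s = 1 / L := by rw [hs]; field_simp
      rw [this, div_le_iff₀ hL0]
      linarith
    calc ENNReal.ofReal 2 = ENNReal.ofReal (2 / c₁) * ENNReal.ofReal c₁ := by
          rw [← ENNReal.ofReal_mul (by positivity), div_mul_cancel₀ _ hc₁0.ne']
      _ ≤ ENNReal.ofReal (C * C₁ + 2 / c₁) * ENNReal.ofReal c₁ := by
          gcongr
          linarith [mul_pos hC hC₁0]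
      _ ≤ _ := by
          gcongr
          exact le_lintegral_pow_of_lipschitz hδ hs0 hs2 h2
  · push Not at hbig
    obtain ⟨z₀⟩ : Nonempty (Sph d) := (sigmaSph d).nonempty_of_neZero
    have hmax : ∀ y : Sph d, ∃ z, ∀ z', L * δ z' - dist z' y ≤ L * δ z - dist z y := fun y => by
      have hcont : Continuous fun z => L * δ z - dist z y :=
        (hδ.continuous.const_mul L).sub (by fun_prop)
      obtain ⟨z, -, hz⟩ := isCompact_univ.exists_isMaxOn ⟨z₀, Set.mem_univ _⟩ hcont.continuousOn
      exact ⟨z, fun z' => hz (Set.mem_univ z')⟩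
    choose Z hZ using hmax
    let ρ : Sph d → ℝ := fun y => L * δ (Z y) - dist (Z y) y
    have hρδ : ∀ y, L * δ y ≤ ρ y := fun y => by simpa using hZ y y
    have hρ0 : ∀ y, 0 < ρ y := fun y => (mul_pos hL0 (h0 y)).trans_le (hρδ y)
    obtain ⟨w, hw⟩ := H n x ρ τ
      (LipschitzWith.of_le_add fun y y' => by
        have h1 := hZ y' (Z y)
        have h2 := dist_triangle (Z y) y y'
        simp only [ρ]
        linarith) hτ
      (fun y => by nlinarith [hτδ y, hρδ y, h0 y])
      (fun y => by
        have := hbig (Z y)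
        simp only [ρ]
        linarith [dist_nonneg (x := Z y) (y := y)])
      (fun y z hz => by
        obtain ⟨j, hj⟩ := hx z
        refine ⟨j, hj.trans ?_⟩
        have h1 := hZ y z
        have h2 := mem_closedBall.1 hz
        have h3 : L * δ z ≤ 2 * ρ y := by
          have h4 : L * δ z ≤ ρ y + dist z y := by simp only [ρ]; linarith
          linarith [hρ0 y]
        rw [hL, div_mul_eq_mul_div, div_le_iff₀ hη] at h3
        linarith)
    refine ⟨w, hw.trans ?_⟩
    have hI := lintegral_pow_le_of_maximal (by linarith) hδ h0 hbig hρ0 Z fun _ => rfl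
    calc _ ≤ _ := mul_le_mul_right hI _
      _ = ENNReal.ofReal (C * C₁) * ∫⁻ z, ENNReal.ofReal (δ z ^ (d + 1)) ∂sigmaSph d := by
          rw [← mul_assoc, ← ENNReal.ofReal_mul hC.le]
      _ ≤ _ := by
          gcongr
          have : 0 ≤ 2 / c₁ := by positivity
          linarith

end Scales

section Geodesic

variable {d n : ℕ}

open scoped ENNReal

lemma dist_eq_two_mul_sin (y z : Sph d) : dist y z = 2 * Real.sin (geoDist y z / 2) := by
  have h := inner_mem_Icc y z
  have hcos : Real.cos (geoDist y z) = ⟪(y : Amb d), (z : Amb d)⟫ := Real.cos_arccos h.1 h.2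
  have h0 : 0 ≤ geoDist y z := Real.arccos_nonneg _
  have hπ : geoDist y z ≤ Real.pi := Real.arccos_le_pi _
  have hs : 0 ≤ Real.sin (geoDist y z / 2) :=
    Real.sin_nonneg_of_nonneg_of_le_pi (by linarith) (by linarith)
  have h1 : dist y z ^ 2 = (2 * Real.sin (geoDist y z / 2)) ^ 2 := by
    have hy : ‖(y : Amb d)‖ = 1 := by simp
    have hz : ‖(z : Amb d)‖ = 1 := by simp
    have h2 : dist y z = ‖(y : Amb d) - (z : Amb d)‖ := dist_eq_norm (y : Amb d) (z : Amb d)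
    rw [h2, norm_sub_sq_real, hy, hz, ← hcos, mul_pow, Real.sin_sq_eq_half_sub]
    rw [show 2 * (geoDist y z / 2) = geoDist y z by ring]
    ring
  exact (sq_eq_sq₀ dist_nonneg (by positivity)).1 h1

lemma dist_le_geoDist (y z : Sph d) : dist y z ≤ geoDist y z := by
  rw [dist_eq_two_mul_sin]
  have h0 : 0 ≤ geoDist y z := Real.arccos_nonneg _
  linarith [Real.sin_le (x := geoDist y z / 2) (by linarith)]

lemma geoDist_le_mul_dist (y z : Sph d) : geoDist y z ≤ Real.pi / 2 * dist y z := by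
  rw [dist_eq_two_mul_sin]
  have h0 : 0 ≤ geoDist y z := Real.arccos_nonneg _
  have hπ : geoDist y z ≤ Real.pi := Real.arccos_le_pi _
  have h := Real.mul_le_sin (x := geoDist y z / 2) (by linarith) (by linarith)
  have hp := Real.pi_pos
  calc geoDist y z = Real.pi * (2 / Real.pi * (geoDist y z / 2)) := by field_simp
    _ ≤ Real.pi * Real.sin (geoDist y z / 2) := by gcongr
    _ = _ := by ring

variable (x : Fin n → Sph d)

lemma iInf_dist_le (z : Sph d) (j : Fin n) : ⨅ j, dist z (x j) ≤ dist z (x j) :=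
  ciInf_le (Set.finite_range _).bddBelow j

lemma measurable_iInf_geoDist : Measurable fun z => ⨅ j, geoDist z (x j) := by
  refine Measurable.iInf fun j => ?_
  unfold geoDist
  exact (Real.continuous_arccos.comp (by fun_prop)).measurable

variable [NeZero n]

lemma exists_dist_eq_iInf (z : Sph d) : ∃ j, dist z (x j) = ⨅ j, dist z (x j) :=
  exists_eq_ciInf_of_finite

lemma lipschitzWith_iInf_dist : LipschitzWith 1 fun z => ⨅ j, dist z (x j) :=
  LipschitzWith.of_le_add fun y z => by
    obtain ⟨j, hj⟩ := exists_dist_eq_iInf x z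
    linarith [iInf_dist_le x y j, dist_triangle y z (x j)]

lemma iInf_dist_le_iInf_geoDist (z : Sph d) : ⨅ j, dist z (x j) ≤ ⨅ j, geoDist z (x j) :=
  le_ciInf fun j => (iInf_dist_le x z j).trans (dist_le_geoDist _ _)

lemma iInf_geoDist_le (z : Sph d) : ⨅ j, geoDist z (x j) ≤ Real.pi / 2 * ⨅ j, dist z (x j) := by
  obtain ⟨j, hj⟩ := exists_dist_eq_iInf x z
  rw [← hj]
  exact (ciInf_le (Set.finite_range _).bddBelow j).trans (geoDist_le_mul_dist _ _)

lemma lintegral_iInf_geoDist : ENNReal.ofReal (∫ z, (⨅ j, geoDist z (x j)) ^ ((d : ℝ) + 1)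
    ∂sigmaSph d) = ∫⁻ z, ENNReal.ofReal ((⨅ j, geoDist z (x j)) ^ (d + 1)) ∂sigmaSph d := by
  have h0 : ∀ z, 0 ≤ ⨅ j, geoDist z (x j) := fun z => le_ciInf fun j => Real.arccos_nonneg _
  have hπ : ∀ z, ⨅ j, geoDist z (x j) ≤ Real.pi := fun z =>
    (ciInf_le (Set.finite_range _).bddBelow 0).trans (Real.arccos_le_pi _)
  have e : ∀ z, (⨅ j, geoDist z (x j)) ^ ((d : ℝ) + 1) = (⨅ j, geoDist z (x j)) ^ (d + 1) :=
    fun z => by exact_mod_cast Real.rpow_natCast _ (d + 1)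
  simp only [e]
  refine ofReal_integral_eq_lintegral_ofReal ?_ (.of_forall fun z => pow_nonneg (h0 z) _)
  refine Integrable.of_bound ((measurable_iInf_geoDist x).pow_const _).aestronglyMeasurable
    (Real.pi ^ (d + 1)) (.of_forall fun z => ?_)
  rw [Real.norm_of_nonneg (pow_nonneg (h0 z) _)]
  exact pow_le_pow_left₀ (h0 z) (hπ z) _

lemma iInf_dist_nonneg (z : Sph d) : 0 ≤ ⨅ j, dist z (x j) := le_ciInf fun _ => dist_nonneg

end Geodesic

section MainBounds

variable {d n : ℕ}

open scoped ENNReal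

lemma sphDisc_nonneg (x : Fin n → Sph d) (w : Fin n → ℝ) : 0 ≤ sphDisc x w := Real.sqrt_nonneg _

lemma integral_iInf_geoDist_nonneg (x : Fin n → Sph d) :
    0 ≤ ∫ z, (⨅ j, geoDist z (x j)) ^ ((d : ℝ) + 1) ∂sigmaSph d :=
  integral_nonneg fun _ => Real.rpow_nonneg (Real.iInf_nonneg fun _ => Real.arccos_nonneg _) _

lemma exists_lower_bound (d : ℕ) : ∃ c : ℝ, 0 < c ∧ ∀ (n : ℕ), 0 < n → ∀ (x : Fin n → Sph d)
    (w : Fin n → ℝ),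
    c * (∫ z, (⨅ j, geoDist z (x j)) ^ ((d : ℝ) + 1) ∂sigmaSph d) ≤ sphDisc x w ^ 2 := by
  obtain ⟨c, hc, H⟩ := sphDisc_sq_ge d
  refine ⟨c / (Real.pi / 2) ^ (d + 1), by have := Real.pi_pos; positivity, ?_⟩
  intro n hn x w
  have : NeZero n := ⟨hn.ne'⟩
  have hp := Real.pi_pos
  have h := H n x w (fun z => ⨅ j, dist z (x j)) (lipschitzWith_iInf_dist x).continuous.measurable
    (iInf_dist_nonneg x)
    (fun z => (iInf_dist_le x z 0).trans (by
      have h1 : dist z (x 0) = ‖(z : Amb d) - (x 0 : Amb d)‖ :=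
        dist_eq_norm (z : Amb d) (x 0 : Amb d)
      have h2 := norm_sub_le (z : Amb d) (x 0 : Amb d)
      have h3 : ‖(z : Amb d)‖ = 1 := by simp
      have h4 : ‖(x 0 : Amb d)‖ = 1 := by simp
      linarith)) (iInf_dist_le x)
  have h1 : ENNReal.ofReal (∫ z, (⨅ j, geoDist z (x j)) ^ ((d : ℝ) + 1) ∂sigmaSph d) ≤
      ENNReal.ofReal ((Real.pi / 2) ^ (d + 1)) *
        ∫⁻ z, ENNReal.ofReal ((⨅ j, dist z (x j)) ^ (d + 1)) ∂sigmaSph d := by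
    rw [lintegral_iInf_geoDist, ← lintegral_const_mul' _ _ ENNReal.ofReal_ne_top]
    refine lintegral_mono fun z => ?_
    rw [← ENNReal.ofReal_mul (by positivity), ← mul_pow]
    exact ENNReal.ofReal_le_ofReal (pow_le_pow_left₀
      ((iInf_dist_nonneg x z).trans (iInf_dist_le_iInf_geoDist x z)) (iInf_geoDist_le x z) _)
  rw [← ENNReal.ofReal_le_ofReal_iff (sq_nonneg _), ENNReal.ofReal_mul (by positivity)]
  refine le_trans (mul_le_mul_right h1 _) ?_
  rwa [← mul_assoc, ← ENNReal.ofReal_mul (by positivity), div_mul_cancel₀ _ (by positivity)]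

lemma exists_upper_bound (d : ℕ) : ∃ C : ℝ, 0 < C ∧ ∀ (n : ℕ), 0 < n → ∀ (x : Fin n → Sph d),
    (⨅ w : Fin n → ℝ, sphDisc x w) ^ 2 ≤
      C * (∫ z, (⨅ j, geoDist z (x j)) ^ ((d : ℝ) + 1) ∂sigmaSph d) := by
  obtain ⟨C, hC, H⟩ := exists_sphDisc_sq_le d
  refine ⟨C * 2 ^ d, by positivity, ?_⟩
  intro n hn x
  have : NeZero n := ⟨hn.ne'⟩
  set I := ∫ z, (⨅ j, geoDist z (x j)) ^ ((d : ℝ) + 1) ∂sigmaSph d with hI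
  have hI0 : 0 ≤ I := integral_iInf_geoDist_nonneg x
  have hbdd : BddBelow (Set.range fun w : Fin n → ℝ => sphDisc x w) :=
    ⟨0, by rintro _ ⟨w, rfl⟩; exact sphDisc_nonneg x w⟩
  have key : ∀ τ : ℝ, 0 < τ → (⨅ w : Fin n → ℝ, sphDisc x w) ^ 2 ≤
      C * 2 ^ d * (I + τ ^ (d + 1)) := by
    intro τ hτ
    obtain ⟨w, hw⟩ := H n x (fun z => (⨅ j, dist z (x j)) + τ) τ
      (LipschitzWith.of_le_add fun y z => by
        have := (lipschitzWith_iInf_dist x).le_add_mul y z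
        rw [NNReal.coe_one, one_mul] at this
        linarith) hτ
      (fun z => by linarith [iInf_dist_nonneg x z])
      (fun z => by
        obtain ⟨j, hj⟩ := exists_dist_eq_iInf x z
        exact ⟨j, by linarith⟩)
    have h1 : ∫⁻ z, ENNReal.ofReal (((⨅ j, dist z (x j)) + τ) ^ (d + 1)) ∂sigmaSph d ≤
        ENNReal.ofReal (2 ^ d * (I + τ ^ (d + 1))) := by
      rw [ENNReal.ofReal_mul (by positivity), ENNReal.ofReal_add hI0 (by positivity), hI,
        lintegral_iInf_geoDist]
      calc _ ≤ ∫⁻ z, ENNReal.ofReal (2 ^ d) * (ENNReal.ofReal ((⨅ j, geoDist z (x j)) ^ (d + 1)) +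
            ENNReal.ofReal (τ ^ (d + 1))) ∂sigmaSph d := by
            refine lintegral_mono fun z => ?_
            have hz := iInf_dist_nonneg x z
            have hz' := iInf_dist_le_iInf_geoDist x z
            have hz'' := hz.trans hz'
            rw [← ENNReal.ofReal_add (by positivity) (by positivity),
              ← ENNReal.ofReal_mul (by positivity)]
            refine ENNReal.ofReal_le_ofReal ?_
            refine (pow_le_pow_left₀ (by positivity) (by gcongr) _).trans
              (add_pow_le hz'' hτ.le (d + 1))
        _ = _ := by
            rw [lintegral_const_mul' _ _ ENNReal.ofReal_ne_top, lintegral_add_right _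
              measurable_const, lintegral_const, measure_univ, mul_one]
    have h2 : sphDisc x w ^ 2 ≤ C * (2 ^ d * (I + τ ^ (d + 1))) := by
      rw [← ENNReal.ofReal_le_ofReal_iff (by positivity), ENNReal.ofReal_mul hC.le]
      exact hw.trans (mul_le_mul_right h1 _)
    rw [mul_assoc]
    exact (pow_le_pow_left₀ (Real.iInf_nonneg (sphDisc_nonneg x)) (ciInf_le hbdd w) 2).trans h2
  refine le_of_forall_pos_le_add fun ε hε => ?_
  have hD : 0 < C * 2 ^ d := by positivity
  set τ := min 1 (ε / (C * 2 ^ d)) with hτ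
  have hτ0 : 0 < τ := lt_min one_pos (by positivity)
  have h1 : τ ^ (d + 1) ≤ ε / (C * 2 ^ d) :=
    (pow_le_of_le_one hτ0.le (min_le_left _ _) (Nat.succ_ne_zero d)).trans (min_le_right _ _)
  rw [le_div_iff₀ hD] at h1
  linarith [key τ hτ0]

lemma rpow_rpow_eq_sqrt {I : ℝ} (hI : 0 ≤ I) (d : ℕ) :
    (I ^ (1 / ((d : ℝ) + 1))) ^ (((d : ℝ) + 1) / 2) = √I := by
  rw [← Real.rpow_mul hI, Real.sqrt_eq_rpow]
  congr 1
  have : (d : ℝ) + 1 ≠ 0 := by positivity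
  field_simp

end MainBounds

/-- the minimal weighted spherical `L_2`-discrepancy of a point set `P`
is equivalent to `‖dist_{S^d}(·,P)‖_{L_{d+1}(σ_d)}^{(d+1)/2}`. -/
theorem minimal_weighted_discrepancy_equiv (d : ℕ) (hd : 0 < d) :
    ∃ c C : ℝ, 0 < c ∧ c ≤ C ∧
      ∀ (n : ℕ), 0 < n → ∀ x : Fin n → Sph d,
        c * ((∫ z, (⨅ j, geoDist z (x j)) ^ ((d : ℝ) + 1) ∂(sigmaSph d))
              ^ (1 / ((d : ℝ) + 1))) ^ (((d : ℝ) + 1) / 2) ≤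
          (⨅ w : Fin n → ℝ, sphDisc x w) ∧
        (⨅ w : Fin n → ℝ, sphDisc x w) ≤
          C * ((∫ z, (⨅ j, geoDist z (x j)) ^ ((d : ℝ) + 1) ∂(sigmaSph d))
              ^ (1 / ((d : ℝ) + 1))) ^ (((d : ℝ) + 1) / 2) := by
  obtain ⟨c, hc, hlow⟩ := exists_lower_bound d
  obtain ⟨C, hC, hup⟩ := exists_upper_bound d
  refine ⟨√c, max (√c) (√C), Real.sqrt_pos.2 hc, le_max_left _ _, fun n hn x => ?_⟩
  rw [rpow_rpow_eq_sqrt (integral_iInf_geoDist_nonneg x)]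
  constructor
  · refine le_ciInf fun w => ?_
    rw [← Real.sqrt_mul hc.le]
    exact Real.sqrt_le_iff.2 ⟨sphDisc_nonneg x w, hlow n hn x w⟩
  · refine le_trans ?_ (mul_le_mul_of_nonneg_right (le_max_right _ _) (Real.sqrt_nonneg _))
    rw [← Real.sqrt_mul hC.le]
    exact Real.le_sqrt_of_sq_le (hup n hn x)

end
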